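/- For every T ∈ ℕ and every length-T dynamic two-sided economy E^T, the set of sophisticated dynamically stable matchings SDS_T(E^T) is nonempty. -/

import Mathlib

/-!
A framework for two-sided, one-to-one, irreversible dynamic matching markets
with conjectures, following Doval's "A framework for (dynamic) stability".

Periods are indexed `0, …, T-1` (the paper's periods `1, …, T`).
-/

namespace DynMatch

open Classical

noncomputable section

/-- A length-`T` two-sided dynamic economy: the arrivals on each side in each period. -/
structure Economy (A B : Type) where
  T : ℕ
  arrA : ℕ → Finset A
  arrB : ℕ → Finset B

/-- Validity of an economy: positive length, pairwise disjoint arrivals, and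
no arrivals outside the horizon. -/
def Economy.Valid {A B : Type} (E : Economy A B) : Prop :=
  0 < E.T ∧
  (∀ s t, s ≠ t → Disjoint (E.arrA s) (E.arrA t)) ∧
  (∀ s t, s ≠ t → Disjoint (E.arrB s) (E.arrB t)) ∧
  (∀ s, E.T ≤ s → E.arrA s = ∅) ∧ (∀ s, E.T ≤ s → E.arrB s = ∅)

/-- A raw dynamic matching: in every period, a partial pairing between the two sides
(`none` means unmatched, i.e. matched to oneself). -/
structure PreMatching (A B : Type) where
  mA : ℕ → A → Option B
  mB : ℕ → B → Option A

variable {A B : Type} [DecidableEq A] [DecidableEq B]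

/-- Side-`A` agents having arrived up to (and including) period `t`. -/
def arrAUpTo (E : Economy A B) (t : ℕ) : Finset A := (Finset.range (t+1)).biUnion E.arrA

/-- Side-`B` agents having arrived up to (and including) period `t`. -/
def arrBUpTo (E : Economy A B) (t : ℕ) : Finset B := (Finset.range (t+1)).biUnion E.arrB

/-- `m` is an irreversible dynamic matching for the economy `E`: in every period it is
an involutive pairing between arrived agents of the two sides, and once matched a
pair stays matched. -/
def IsMatching (E : Economy A B) (m : PreMatching A B) : Prop :=
  (∀ t a b, t < E.T → (m.mA t a = some b ↔ m.mB t b = some a)) ∧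
  (∀ t a, t < E.T → m.mA t a ≠ none → a ∈ arrAUpTo E t) ∧
  (∀ t a b, t < E.T → m.mA t a = some b → b ∈ arrBUpTo E t) ∧
  (∀ t s a, t ≤ s → s < E.T → m.mA t a ≠ none → m.mA s a = m.mA t a) ∧
  (∀ t s b, t ≤ s → s < E.T → m.mB t b ≠ none → m.mB s b = m.mB t b)

/-- The everywhere-unmatched prematching. -/
def emptyM : PreMatching A B := ⟨fun _ _ => none, fun _ _ => none⟩

/-- An agent of the economy: a side-`A` or a side-`B` agent. -/
abbrev Agent (A B : Type) := A ⊕ B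

/-- `𝒜_t(m^{t-1})`: side-`A` agents available to match in period `t` given history `m`. -/
def availA (E : Economy A B) (m : PreMatching A B) (t : ℕ) : Finset A :=
  (arrAUpTo E t).filter fun a => ∀ s, s < t → m.mA s a = none

/-- `ℬ_t(m^{t-1})`: side-`B` agents available to match in period `t` given history `m`. -/
def availB (E : Economy A B) (m : PreMatching A B) (t : ℕ) : Finset B :=
  (arrBUpTo E t).filter fun b => ∀ s, s < t → m.mB s b = none

/-- `k ∈ 𝒜_t(m^{t-1}) ∪ ℬ_t(m^{t-1})`. -/
def isAvail (E : Economy A B) (m : PreMatching A B) (t : ℕ) : Agent A B → Prop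
  | Sum.inl a => a ∈ availA E m t
  | Sum.inr b => b ∈ availB E m t

/-- `k ∈ A_1 ∪ B_1`: `k` is a first-period arrival. -/
def inPeriodOne (E : Economy A B) : Agent A B → Prop
  | Sum.inl a => a ∈ E.arrA 0
  | Sum.inr b => b ∈ E.arrB 0

/-- `m_t(k) = k`: agent `k` is unmatched in period `t` under `m`. -/
def unmatchedAt (m : PreMatching A B) (t : ℕ) : Agent A B → Prop
  | Sum.inl a => m.mA t a = none
  | Sum.inr b => m.mB t b = none

/-- `m` and `m'` agree in all periods `s < t` (i.e. they share the history `m^{t-1}`). -/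
def agreeUpTo (m m' : PreMatching A B) (t : ℕ) : Prop :=
  ∀ s, s < t → (∀ a, m.mA s a = m'.mA s a) ∧ (∀ b, m.mB s b = m'.mB s b)

/-- Agent `k` is unmatched through period `t` (all periods `s ≤ t`) under `m`. -/
def unmatchedThrough (m : PreMatching A B) (t : ℕ) : Agent A B → Prop
  | Sum.inl a => ∀ s, s ≤ t → m.mA s a = none
  | Sum.inr b => ∀ s, s ≤ t → m.mB s b = none

/-- `M_T(m^{t-1})`: matchings of `E` agreeing with `m` through period `t-1`. -/
def MSetH (E : Economy A B) (m : PreMatching A B) (t : ℕ) : Set (PreMatching A B) :=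
  {m' | IsMatching E m' ∧ agreeUpTo m m' t}

/-- `M_T(m^{t-1}, k)`: matchings of `E` agreeing with `m` through period `t-1` and
leaving `k` unmatched through period `t`. -/
def MSet (E : Economy A B) (m : PreMatching A B) (t : ℕ) (k : Agent A B) :
    Set (PreMatching A B) :=
  {m' | IsMatching E m' ∧ agreeUpTo m m' t ∧ unmatchedThrough m' t k}

/-- Preferences: Bernoulli utilities on both sides and discount factors.
(The payoff of remaining single is normalized to `0`.) -/
structure Pref (A B : Type) where
  u : A → B → ℝ
  v : A → B → ℝ
  dA : A → ℝ
  dB : B → ℝ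

/-- Discount factors lie in `[0,1]`. -/
def Pref.Valid (P : Pref A B) : Prop :=
  (∀ a, 0 ≤ P.dA a ∧ P.dA a ≤ 1) ∧ (∀ b, 0 ≤ P.dB b ∧ P.dB b ≤ 1)

/-- `t_m(a)`: the first period `s ≥ t` at which `a` is matched under `m` (`T` if never). -/
def matchTimeA (E : Economy A B) (m : PreMatching A B) (t : ℕ) (a : A) : ℕ :=
  min (sInf {s | t ≤ s ∧ m.mA s a ≠ none}) E.T

/-- `t_m(b)`: the first period `s ≥ t` at which `b` is matched under `m` (`T` if never). -/
def matchTimeB (E : Economy A B) (m : PreMatching A B) (t : ℕ) (b : B) : ℕ :=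
  min (sInf {s | t ≤ s ∧ m.mB s b ≠ none}) E.T

/-- `U_t(a,m) = δ_a^{t_m(a)-t}·u(a, m_T(a))` (and `0` if `a` ends up unmatched). -/
def Upay (P : Pref A B) (E : Economy A B) (m : PreMatching A B) (t : ℕ) (a : A) : ℝ :=
  match m.mA (E.T - 1) a with
  | none => 0
  | some b => P.dA a ^ (matchTimeA E m t a - t) * P.u a b

/-- `V_t(b,m) = δ_b^{t_m(b)-t}·v(m_T(b), b)` (and `0` if `b` ends up unmatched). -/
def Vpay (P : Pref A B) (E : Economy A B) (m : PreMatching A B) (t : ℕ) (b : B) : ℝ :=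
  match m.mB (E.T - 1) b with
  | none => 0
  | some a => P.dB b ^ (matchTimeB E m t b - t) * P.v a b

/-- A family of conjectures `Φ`: for every period `t`, history `m^{t-1}` and agent `k`,
a set `φ_t(m^{t-1},k)` of matchings `k` considers possible upon remaining unmatched. -/
abbrev ConjFam (A B : Type) := ℕ → PreMatching A B → Agent A B → Set (PreMatching A B)

/-- Validity of a family of conjectures for `E`: conjectures are (nonempty) subsets of
`M_T(m^{t-1},k)` and depend on the matching only through the history `m^{t-1}`. -/
def ConjFam.Valid (E : Economy A B) (φ : ConjFam A B) : Prop :=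
  (∀ t m k, φ t m k ⊆ MSet E m t k) ∧
  (∀ t m m' k, agreeUpTo m m' t → φ t m k = φ t m' k) ∧
  (∀ t m k, t < E.T → IsMatching E m → isAvail E m t k → (φ t m k).Nonempty)

/-- `m` is a `Φ`-solution for `E` (Definition 3): in every period, every available agent
weakly prefers `m` to some conjectured matching, and no available pair blocks. -/
def IsSolution (P : Pref A B) (E : Economy A B) (φ : ConjFam A B)
    (m : PreMatching A B) : Prop :=
  IsMatching E m ∧
  ∀ t, t < E.T →
    ((∀ a ∈ availA E m t, ∃ m' ∈ φ t m (Sum.inl a), Upay P E m' t a ≤ Upay P E m t a) ∧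
     (∀ b ∈ availB E m t, ∃ m' ∈ φ t m (Sum.inr b), Vpay P E m' t b ≤ Vpay P E m t b) ∧
     (∀ a ∈ availA E m t, ∀ b ∈ availB E m t,
        ¬(P.u a b > Upay P E m t a ∧ P.v a b > Vpay P E m t b)))

/-- `Σ^Φ_T(E)`: the set of `Φ`-solutions of `E`. -/
def SolSet (P : Pref A B) (E : Economy A B) (φ : ConjFam A B) : Set (PreMatching A B) :=
  {m | IsSolution P E φ m}

/-- The static (Gale–Shapley) notion of stability, for length-1 economies:
individual rationality plus absence of blocking pairs. -/
def Stable1 (P : Pref A B) (E : Economy A B) (m : PreMatching A B) : Prop :=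
  IsMatching E m ∧
  (∀ a b, m.mA (E.T - 1) a = some b → 0 ≤ P.u a b) ∧
  (∀ b a, m.mB (E.T - 1) b = some a → 0 ≤ P.v a b) ∧
  (∀ a ∈ E.arrA 0, ∀ b ∈ E.arrB 0,
     ¬(P.u a b > Upay P E m 0 a ∧ P.v a b > Vpay P E m 0 b))

/-- The worst (minimal) period-`t` payoff of `a` over the set `C (inl a)` of matchings. -/
def wA (P : Pref A B) (E : Economy A B) (t : ℕ)
    (C : Agent A B → Set (PreMatching A B)) (a : A) : ℝ :=
  sInf ((fun m' => Upay P E m' t a) '' C (Sum.inl a))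

/-- The worst (minimal) period-`t` payoff of `b` over the set `C (inr b)` of matchings. -/
def wB (P : Pref A B) (E : Economy A B) (t : ℕ)
    (C : Agent A B → Set (PreMatching A B)) (b : B) : ℝ :=
  sInf ((fun m' => Vpay P E m' t b) '' C (Sum.inr b))

/-- Utility of side-`A` agent `a` in the induced one-period economy with outside
option value `W a` (truncated preferences). -/
def indU (P : Pref A B) (W : A → ℝ) (a : A) : Option B → ℝ
  | none => W a
  | some b => P.u a b

/-- Utility of side-`B` agent `b` in the induced one-period economy with outside
option value `W b` (truncated preferences). -/
def indV (P : Pref A B) (W : B → ℝ) (b : B) : Option A → ℝ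
  | none => W b
  | some a => P.v a b

/-- The period-`t` component of `mbar` is a stable matching of the one-period economy
`E_{t,φ}(m^{t-1})` induced by the conjecture profile `C` (Definition 6): matching among
the available agents, individually rational w.r.t. the worst-conjecture thresholds,
and without blocking pairs in the truncated preferences. -/
def StableInduced (P : Pref A B) (E : Economy A B) (m : PreMatching A B) (t : ℕ)
    (C : Agent A B → Set (PreMatching A B)) (mbar : PreMatching A B) : Prop :=
  (∀ a ∈ availA E m t, ∀ b, mbar.mA t a = some b → b ∈ availB E m t ∧ mbar.mB t b = some a) ∧
  (∀ b ∈ availB E m t, ∀ a, mbar.mB t b = some a → a ∈ availA E m t ∧ mbar.mA t a = some b) ∧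
  (∀ a ∈ availA E m t, ∀ b, mbar.mA t a = some b → wA P E t C a ≤ P.u a b) ∧
  (∀ b ∈ availB E m t, ∀ a, mbar.mB t b = some a → wB P E t C b ≤ P.v a b) ∧
  (∀ a ∈ availA E m t, ∀ b ∈ availB E m t,
     ¬(P.u a b > indU P (wA P E t C) a (mbar.mA t a) ∧
       P.v a b > indV P (wB P E t C) b (mbar.mB t b)))

/-- `mbar_t` is stable among those who match in period `t` relative to the conjecture
profile `C` (Definition 7): every available agent matched in period `t` weakly prefers
its partner to its worst conjectured matching, and no pair of agents both matched in
period `t` blocks. -/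
def StableAmongMatched (P : Pref A B) (E : Economy A B) (m : PreMatching A B) (t : ℕ)
    (C : Agent A B → Set (PreMatching A B)) (mbar : PreMatching A B) : Prop :=
  (∀ a ∈ availA E m t, ∀ b, mbar.mA t a = some b → wA P E t C a ≤ P.u a b) ∧
  (∀ b ∈ availB E m t, ∀ a, mbar.mB t b = some a → wB P E t C b ≤ P.v a b) ∧
  (∀ a ∈ availA E m t, ∀ b ∈ availB E m t, ∀ b' a',
     mbar.mA t a = some b' → mbar.mB t b = some a' →
     ¬(P.u a b > P.u a b' ∧ P.v a b > P.v a' b))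

/-- `E_t^T(m^{t-1})`: the continuation economy starting at period `t` given history `m`:
its first-period arrivals are the agents available at `t`, later arrivals are unchanged. -/
def contEconomy (E : Economy A B) (m : PreMatching A B) (t : ℕ) : Economy A B where
  T := E.T - t
  arrA := fun s => if s = 0 then availA E m t else E.arrA (t + s)
  arrB := fun s => if s = 0 then availB E m t else E.arrB (t + s)

/-- The restriction of `m` to the continuation economy starting in period `t`:
time is shifted by `t` and agents matched strictly before `t` are dropped. -/
def restrictM (m : PreMatching A B) (t : ℕ) : PreMatching A B where
  mA := fun s a => if ∀ s', s' < t → m.mA s' a = none then m.mA (t + s) a else none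
  mB := fun s b => if ∀ s', s' < t → m.mB s' b = none then m.mB (t + s) b else none

/-- The matching of the original economy corresponding to history `m` through period
`t-1` followed by the continuation matching `m'` (indexed from `0`) of the
continuation economy. -/
def splice (m m' : PreMatching A B) (t : ℕ) : PreMatching A B where
  mA := fun s a => if s < t then m.mA s a
    else if ∀ s', s' < t → m.mA s' a = none then m'.mA (s - t) a
    else m.mA (t - 1) a
  mB := fun s b => if s < t then m.mB s b
    else if ∀ s', s' < t → m.mB s' b = none then m'.mB (s - t) b
    else m.mB (t - 1) b

/-- The family of conjectures that the family `φ` of the original economy induces on the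
continuation economy `E_t^T(m^{t-1})`: at a continuation history, it is the (restriction
of the) original conjectures at the corresponding original history. -/
def contConj (E : Economy A B) (φ : ConjFam A B) (m : PreMatching A B) (t : ℕ) :
    ConjFam A B :=
  fun s mbar k => (fun m' => restrictM m' t) '' φ (t + s) (splice m mbar t) k

/-- The conjectures of eq. (2): the agent only rules out continuation matchings that do
not conform with the solution concept `S` from tomorrow onward. -/
def starConj (S : Economy A B → Set (PreMatching A B)) (E : Economy A B) : ConjFam A B :=
  fun t m k =>
    {m' | m' ∈ MSet E m t k ∧ restrictM m' (t+1) ∈ S (contEconomy E m' (t+1))}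

/-- `S` is the solution correspondence `Σ*` recursively generated by the conjectures of
eq. (2): stability for one-period economies, `Φ*`-solutions for longer economies
(empty continuations impose no restriction). -/
def IsStarFamily (P : Pref A B) (S : Economy A B → Set (PreMatching A B)) : Prop :=
  (∀ E : Economy A B, E.T = 0 → S E = Set.univ) ∧
  (∀ E : Economy A B, E.T = 1 → S E = {m | Stable1 P E m}) ∧
  (∀ E : Economy A B, 2 ≤ E.T → S E = SolSet P E (starConj S E))

/-- The decreasing recursion defining the CVR conjectures at period `t`, history `m`,
relative to the continuation solution correspondence `DS`. -/
def cvrIter (P : Pref A B) (E : Economy A B)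
    (DS : Economy A B → Set (PreMatching A B)) (t : ℕ) (m : PreMatching A B) :
    ℕ → Agent A B → Set (PreMatching A B)
  | 0 => fun k => MSet E m t k
  | n+1 => fun k =>
      {mbar | mbar ∈ MSet E m t k ∧
        StableAmongMatched P E m t (cvrIter P E DS t m n) mbar ∧
        restrictM mbar (t+1) ∈ DS (contEconomy E mbar (t+1))}

/-- The CVR conjectures `φ_{D̂S,t}(m^{t-1},·)`: the limit (intersection) of the
decreasing recursion `cvrIter`. -/
def cvrConj (P : Pref A B) (DS : Economy A B → Set (PreMatching A B))
    (E : Economy A B) : ConjFam A B :=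
  fun t m k => ⋂ n, cvrIter P E DS t m n k

/-- `DS` is the CVR-dynamic-stability correspondence `D̂S`: stable matchings for
one-period economies, `Φ_{D̂S}`-solutions for longer economies. -/
def IsCVRFamily (P : Pref A B) (DS : Economy A B → Set (PreMatching A B)) : Prop :=
  (∀ E : Economy A B, E.T = 0 → DS E = Set.univ) ∧
  (∀ E : Economy A B, E.T = 1 → DS E = {m | Stable1 P E m}) ∧
  (∀ E : Economy A B, 2 ≤ E.T → DS E = SolSet P E (cvrConj P DS E))

/-- The dynamic-stability conjectures of Doval (2022): the period-`t` matching is stable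
among those who match relative to individually rational continuation values, and the
continuation is dynamically stable. -/
def dsConj (P : Pref A B) (DSol : Economy A B → Set (PreMatching A B))
    (E : Economy A B) : ConjFam A B :=
  fun t m k =>
    {mbar | mbar ∈ MSet E m t k ∧
      (∀ a ∈ availA E m t, ∀ b, mbar.mA t a = some b → 0 ≤ P.u a b) ∧
      (∀ b ∈ availB E m t, ∀ a, mbar.mB t b = some a → 0 ≤ P.v a b) ∧
      (∀ a ∈ availA E m t, ∀ b ∈ availB E m t, ∀ b' a',
         mbar.mA t a = some b' → mbar.mB t b = some a' →
         ¬(P.u a b > P.u a b' ∧ P.v a b > P.v a' b)) ∧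
      restrictM mbar (t+1) ∈ DSol (contEconomy E mbar (t+1))}

/-- `DSol` is the dynamic-stability correspondence `DS` of Doval (2022). -/
def IsDSFamily (P : Pref A B) (DSol : Economy A B → Set (PreMatching A B)) : Prop :=
  (∀ E : Economy A B, E.T = 0 → DSol E = Set.univ) ∧
  (∀ E : Economy A B, E.T = 1 → DSol E = {m | Stable1 P E m}) ∧
  (∀ E : Economy A B, 2 ≤ E.T → DSol E = SolSet P E (dsConj P DSol E))

/-- `E_{\k}`: the economy identical to `E` except that agent `k`'s arrival is delayed
by one period (from period `0` to period `1`). -/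
def delayEconomy (E : Economy A B) : Agent A B → Economy A B
  | Sum.inl a =>
      { T := E.T
        arrA := fun s => if s = 0 then E.arrA 0 \ {a}
                 else if s = 1 then insert a (E.arrA 1) else E.arrA s
        arrB := E.arrB }
  | Sum.inr b =>
      { T := E.T
        arrA := E.arrA
        arrB := fun s => if s = 0 then E.arrB 0 \ {b}
                 else if s = 1 then insert b (E.arrB 1) else E.arrB s }

/-- The candidate set `M*(m^{t-1}, C, Scont)`: matchings whose period-`t` matching is
stable in the one-period economy induced by the continuation-value sets `C`, and whose
continuation lies in `Scont` of the induced continuation economy. -/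
def candT (P : Pref A B) (Scont : Economy A B → Set (PreMatching A B))
    (E : Economy A B) (t : ℕ) (m : PreMatching A B)
    (C : Agent A B → Set (PreMatching A B)) : Set (PreMatching A B) :=
  {mbar | mbar ∈ MSetH E m t ∧ StableInduced P E m t C mbar ∧
    restrictM mbar (t+1) ∈ Scont (contEconomy E mbar (t+1))}

/-- The increasing recursion `F_n` defining the sophisticated-dynamic-stability
conjectures at period `t`, history `m`, relative to the correspondence `SDS` on
strictly shorter problems. -/
def sdsF (P : Pref A B) (SDS : Economy A B → Set (PreMatching A B))
    (E : Economy A B) (t : ℕ) (m : PreMatching A B) :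
    ℕ → Agent A B → Set (PreMatching A B)
  | 0 => fun k =>
      {mbar | mbar ∈ MSet E m t k ∧
        restrictM mbar t ∈ SDS (delayEconomy (contEconomy E m t) k)}
  | n+1 => fun k => sdsF P SDS E t m n k ∪
      {mbar | mbar ∈ candT P SDS E t m (sdsF P SDS E t m n) ∧ unmatchedAt mbar t k}

/-- The SDS conjectures `φ_{SDS,t}`: the limit (union) of the increasing recursion `F_n`. -/
def sdsConj (P : Pref A B) (SDS : Economy A B → Set (PreMatching A B))
    (E : Economy A B) : ConjFam A B :=
  fun t m k => ⋃ n, sdsF P SDS E t m n k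

/-- `SDS` is the sophisticated-dynamic-stability correspondence. -/
def IsSDSFamily (P : Pref A B) (SDS : Economy A B → Set (PreMatching A B)) : Prop :=
  (∀ E : Economy A B, E.T = 0 → SDS E = Set.univ) ∧
  (∀ E : Economy A B, E.T = 1 → SDS E = {m | Stable1 P E m}) ∧
  (∀ E : Economy A B, 2 ≤ E.T → SDS E = SolSet P E (sdsConj P SDS E))

/-- The rational-expectations conjectures: `k` conjectures exactly the `RE` solutions of
the continuation economy in which `k`'s arrival is delayed by one period. -/
def reConj (RE : Economy A B → Set (PreMatching A B)) (E : Economy A B) : ConjFam A B :=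
  fun t m k =>
    {mbar | mbar ∈ MSet E m t k ∧
      restrictM mbar t ∈ RE (delayEconomy (contEconomy E m t) k)}

/-- `RE` is the rational-expectations solution correspondence. -/
def IsREFamily (P : Pref A B) (RE : Economy A B → Set (PreMatching A B)) : Prop :=
  (∀ E : Economy A B, E.T = 1 → RE E = {m | Stable1 P E m}) ∧
  (∀ E : Economy A B, 2 ≤ E.T → RE E = SolSet P E (reConj RE E))


section


variable {E : Economy A B} {m m' : PreMatching A B}

/-! ### Exchanging the two sides -/

/-- The economy with the roles of the two sides exchanged. -/
def Economy.swap {A B : Type} (E : Economy A B) : Economy B A := ⟨E.T, E.arrB, E.arrA⟩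

/-- The matching with the roles of the two sides exchanged. -/
def PreMatching.swap {A B : Type} (m : PreMatching A B) : PreMatching B A := ⟨m.mB, m.mA⟩

/-- The preferences with the roles of the two sides exchanged. -/
def Pref.swap {A B : Type} (P : Pref A B) : Pref B A :=
  ⟨fun b a => P.v a b, fun b a => P.u a b, P.dB, P.dA⟩

/-- Arrivals in different periods are disjoint. -/
def Economy.Disj {A B : Type} (E : Economy A B) : Prop :=
  (∀ s t, s ≠ t → Disjoint (E.arrA s) (E.arrA t)) ∧
  (∀ s t, s ≠ t → Disjoint (E.arrB s) (E.arrB t))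

theorem Economy.Disj.swap {A B : Type} {E : Economy A B} (h : E.Disj) : E.swap.Disj :=
  ⟨h.2, h.1⟩

theorem Economy.Disj.eqA {A B : Type} {E : Economy A B} (h : E.Disj) {a : A} {s t : ℕ}
    (hs : a ∈ E.arrA s) (ht : a ∈ E.arrA t) : s = t := by
  by_contra hne
  exact Finset.disjoint_left.mp (h.1 s t hne) hs ht

omit [DecidableEq B] in
theorem mem_arrAUpTo {a : A} {t : ℕ} : a ∈ arrAUpTo E t ↔ ∃ s ≤ t, a ∈ E.arrA s := by
  simp [arrAUpTo]

omit [DecidableEq A] in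
theorem mem_arrBUpTo {b : B} {t : ℕ} : b ∈ arrBUpTo E t ↔ ∃ s ≤ t, b ∈ E.arrB s :=
  mem_arrAUpTo (E := E.swap)

omit [DecidableEq B] in
theorem mem_availA {a : A} {t : ℕ} :
    a ∈ availA E m t ↔ (∃ s ≤ t, a ∈ E.arrA s) ∧ ∀ s, s < t → m.mA s a = none := by
  simp [availA, mem_arrAUpTo]

omit [DecidableEq A] in
theorem mem_availB {b : B} {t : ℕ} :
    b ∈ availB E m t ↔ (∃ s ≤ t, b ∈ E.arrB s) ∧ ∀ s, s < t → m.mB s b = none :=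
  mem_availA (E := E.swap) (m := m.swap)

theorem IsMatching.swap (h : IsMatching E m) : IsMatching E.swap m.swap := by
  obtain ⟨h1, h2, h3, h4, h5⟩ := h
  refine ⟨fun t b a ht => (h1 t a b ht).symm, fun t b ht hb => ?_, fun t b a ht hb => ?_, h5, h4⟩
  · obtain ⟨a, ha⟩ := Option.ne_none_iff_exists'.mp hb
    exact h3 t a b ht ((h1 t a b ht).mpr ha)
  · have := (h1 t a b ht).mpr hb
    exact h2 t a ht (by simp [this])

/-! ### Basic identities for continuation economies -/

omit [DecidableEq B] in
theorem availA_zero : availA E m 0 = E.arrA 0 := by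
  ext a; simp [mem_availA]

omit [DecidableEq A] in
theorem availB_zero : availB E m 0 = E.arrB 0 :=
  availA_zero (E := E.swap) (m := m.swap)

theorem contEconomy_zero : contEconomy E m 0 = E := by
  cases E
  simp only [contEconomy, Economy.mk.injEq, Nat.sub_zero, true_and]
  constructor
  · funext s
    split_ifs with h
    · rw [availA_zero, h]
    · rw [zero_add]
  · funext s
    split_ifs with h
    · rw [availB_zero, h]
    · rw [zero_add]

omit [DecidableEq A] [DecidableEq B] in
theorem restrictM_zero : restrictM m 0 = m := by
  cases m
  simp [restrictM]

omit [DecidableEq A] [DecidableEq B] in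
theorem restrictM_one_mA {s : ℕ} {a : A} :
    (restrictM m 1).mA s a = if m.mA 0 a = none then m.mA (s + 1) a else none := by
  simp [restrictM, add_comm]

omit [DecidableEq A] [DecidableEq B] in
theorem restrictM_one_mB {s : ℕ} {b : B} :
    (restrictM m 1).mB s b = if m.mB 0 b = none then m.mB (s + 1) b else none :=
  restrictM_one_mA (m := m.swap)

omit [DecidableEq A] [DecidableEq B] in
theorem restrictM_restrictM_mA (t s : ℕ) (a : A) :
    (restrictM (restrictM m 1) t).mA s a = (restrictM m (t + 1)).mA s a := by
  have key : (∀ s', s' < t + 1 → m.mA s' a = none) ↔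
      m.mA 0 a = none ∧ ∀ s', s' < t → m.mA (s' + 1) a = none :=
    Nat.forall_lt_succ_left
  by_cases h0 : m.mA 0 a = none
  · simp only [restrictM, key, h0, true_and]
    simp [h0, add_comm 1, add_assoc]
  · simp only [restrictM, key, h0]
    simp [h0]

omit [DecidableEq A] [DecidableEq B] in
theorem restrictM_restrictM (t : ℕ) : restrictM (restrictM m 1) t = restrictM m (t + 1) := by
  have hA : (restrictM (restrictM m 1) t).mA = (restrictM m (t + 1)).mA := by
    funext s a; exact restrictM_restrictM_mA t s a
  have hB : (restrictM (restrictM m 1) t).mB = (restrictM m (t + 1)).mB := by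
    funext s b; exact restrictM_restrictM_mA (m := m.swap) t s b
  exact congrArg₂ PreMatching.mk hA hB

theorem mem_contEconomy_arrA {a : A} {s : ℕ} :
    a ∈ (contEconomy E m 1).arrA s ↔
      (s = 0 ∧ a ∈ E.arrA 0 ∧ m.mA 0 a = none) ∨
      (s = 0 ∧ a ∈ E.arrA 1 ∧ m.mA 0 a = none) ∨ (s ≠ 0 ∧ a ∈ E.arrA (s + 1)) := by
  by_cases hs : s = 0
  · simp [contEconomy, hs, mem_availA, Nat.le_one_iff_eq_zero_or_eq_one, or_and_right, exists_or]
  · simp [contEconomy, hs, add_comm]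

/-- Agents matched in the first period have arrived in the first period. -/
theorem IsMatching.arrA_zero (hm : IsMatching E m) (hT : 0 < E.T) {a : A}
    (h : m.mA 0 a ≠ none) : a ∈ E.arrA 0 := by
  simpa [mem_arrAUpTo] using hm.2.1 0 a hT h

theorem mem_arrAUpTo_contEconomy (hD : E.Disj) (hm : IsMatching E m) (hT : 0 < E.T)
    {a : A} {t : ℕ} :
    a ∈ arrAUpTo (contEconomy E m 1) t ↔ a ∈ arrAUpTo E (t + 1) ∧ m.mA 0 a = none := by
  simp only [mem_arrAUpTo, mem_contEconomy_arrA]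
  constructor
  · rintro ⟨s, hs, ⟨rfl, h, h'⟩ | ⟨rfl, h, h'⟩ | ⟨h0, h⟩⟩
    · exact ⟨⟨0, by omega, h⟩, h'⟩
    · exact ⟨⟨1, by omega, h⟩, h'⟩
    · refine ⟨⟨s + 1, by omega, h⟩, ?_⟩
      by_contra hne
      have := hD.eqA h (hm.arrA_zero hT hne)
      omega
  · rintro ⟨⟨s, hs, h⟩, h'⟩
    rcases s with _ | _ | s
    · exact ⟨0, by omega, Or.inl ⟨rfl, h, h'⟩⟩
    · exact ⟨0, by omega, Or.inr (Or.inl ⟨rfl, h, h'⟩)⟩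
    · exact ⟨s + 1, by omega, Or.inr (Or.inr ⟨by omega, h⟩)⟩

theorem mem_arrBUpTo_contEconomy (hD : E.Disj) (hm : IsMatching E m) (hT : 0 < E.T)
    {b : B} {t : ℕ} :
    b ∈ arrBUpTo (contEconomy E m 1) t ↔ b ∈ arrBUpTo E (t + 1) ∧ m.mB 0 b = none :=
  mem_arrAUpTo_contEconomy hD.swap hm.swap hT

theorem availA_contEconomy (hD : E.Disj) (hm : IsMatching E m) (hT : 0 < E.T) (t : ℕ) :
    availA (contEconomy E m 1) (restrictM m 1) t = availA E m (t + 1) := by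
  ext a
  rw [mem_availA, mem_availA, ← mem_arrAUpTo, ← mem_arrAUpTo, mem_arrAUpTo_contEconomy hD hm hT,
    Nat.forall_lt_succ_left, and_assoc]
  refine and_congr_right fun _ => and_congr_right fun h => ?_
  simp [restrictM_one_mA, h]

theorem availB_contEconomy (hD : E.Disj) (hm : IsMatching E m) (hT : 0 < E.T) (t : ℕ) :
    availB (contEconomy E m 1) (restrictM m 1) t = availB E m (t + 1) :=
  availA_contEconomy hD.swap hm.swap hT t

theorem contEconomy_contEconomy (hD : E.Disj) (hm : IsMatching E m) (hT : 0 < E.T) (t : ℕ) :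
    contEconomy (contEconomy E m 1) (restrictM m 1) t = contEconomy E m (t + 1) := by
  have hA : (contEconomy (contEconomy E m 1) (restrictM m 1) t).arrA =
      (contEconomy E m (t + 1)).arrA := by
    funext s
    by_cases hs : s = 0
    · subst hs
      exact availA_contEconomy hD hm hT t
    · simp [contEconomy, hs, add_comm 1, add_assoc]
  have hB : (contEconomy (contEconomy E m 1) (restrictM m 1) t).arrB =
      (contEconomy E m (t + 1)).arrB := by
    funext s
    by_cases hs : s = 0
    · subst hs
      exact availB_contEconomy hD hm hT t
    · simp [contEconomy, hs, add_comm 1, add_assoc]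
  have hT' : (contEconomy (contEconomy E m 1) (restrictM m 1) t).T = (contEconomy E m (t + 1)).T := by
    simp only [contEconomy]; omega
  rw [Economy.mk.injEq]
  exact ⟨hT', hA, hB⟩

theorem Economy.Disj.contEconomy (hD : E.Disj) : (contEconomy E m 1).Disj := by
  have aux : ∀ {A B : Type} [DecidableEq A] [DecidableEq B] {E : Economy A B}
      {m : PreMatching A B}, E.Disj → ∀ s t, s ≠ t →
        Disjoint ((DynMatch.contEconomy E m 1).arrA s) ((DynMatch.contEconomy E m 1).arrA t) := by
    intro A B _ _ E m hD s t hst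
    rw [Finset.disjoint_left]
    intro a hs ht
    rw [mem_contEconomy_arrA] at hs ht
    rcases hs with ⟨rfl, hs, -⟩ | ⟨rfl, hs, -⟩ | ⟨h0, hs⟩ <;>
    rcases ht with ⟨rfl, ht, -⟩ | ⟨rfl, ht, -⟩ | ⟨h1, ht⟩ <;>
    · have := hD.eqA hs ht
      omega
  exact ⟨aux hD, aux (E := E.swap) (m := m.swap) hD.swap⟩

/-! ### Restricting and splicing matchings -/

theorem IsMatching.restrict (hD : E.Disj) (hT : 0 < E.T) (hm : IsMatching E m) :
    IsMatching (contEconomy E m 1) (restrictM m 1) := by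
  have aux : ∀ {A B : Type} [DecidableEq A] [DecidableEq B] {E : Economy A B}
      {m : PreMatching A B}, 0 < E.T → IsMatching E m → ∀ t a b, t + 1 < E.T →
        (restrictM m 1).mA t a = some b → (restrictM m 1).mB t b = some a := by
    intro A B _ _ E m hT hm t a b ht h
    rw [restrictM_one_mA] at h
    split_ifs at h with h0
    have hb := (hm.1 (t + 1) a b ht).mp h
    rw [restrictM_one_mB, if_pos, hb]
    by_contra hne
    have h2 := hm.2.2.2.2 0 (t + 1) b (by omega) ht hne
    rw [hb] at h2
    have := (hm.1 0 a b hT).mpr h2.symm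
    simp [h0] at this
  have auxI : ∀ {A B : Type} [DecidableEq A] [DecidableEq B] {E : Economy A B}
      {m : PreMatching A B}, IsMatching E m → ∀ t s a, t ≤ s → s + 1 < E.T →
        (restrictM m 1).mA t a ≠ none → (restrictM m 1).mA s a = (restrictM m 1).mA t a := by
    intro A B _ _ E m hm t s a hts hs h
    rw [restrictM_one_mA] at h ⊢
    split_ifs at h ⊢ with h0
    · rw [restrictM_one_mA, if_pos h0]
      exact hm.2.2.2.1 _ _ a (by omega) hs h
    · exact absurd rfl h
  have hTE : (DynMatch.contEconomy E m 1).T = E.T - 1 := rfl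
  refine ⟨fun t a b ht => ⟨aux hT hm t a b (by omega), ?_⟩, ?_, ?_, ?_, ?_⟩
  · exact aux (E := E.swap) (m := m.swap) hT hm.swap t b a (by change t + 1 < E.T; omega)
  · intro t a ht h
    rw [mem_arrAUpTo_contEconomy hD hm hT]
    rw [restrictM_one_mA] at h
    split_ifs at h with h0
    · exact ⟨hm.2.1 _ a (by omega) h, h0⟩
    · exact absurd rfl h
  · intro t a b ht h
    rw [mem_arrBUpTo_contEconomy hD hm hT]
    have hb := aux hT hm t a b (by omega) h
    rw [restrictM_one_mB] at hb
    rw [restrictM_one_mA] at h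
    split_ifs at h hb with h0 h1
    exact ⟨hm.2.2.1 _ a b (by omega) h, h1⟩
  · exact fun t s a hts hs => auxI hm t s a hts (by omega)
  · exact fun t s b hts hs =>
      auxI (E := E.swap) (m := m.swap) hm.swap t s b hts (by change s + 1 < E.T; omega)

omit [DecidableEq A] [DecidableEq B] in
theorem splice_one_mA_zero {a : A} : (splice m m' 1).mA 0 a = m.mA 0 a := by
  simp [splice]

omit [DecidableEq A] [DecidableEq B] in
theorem splice_one_mA_succ {s : ℕ} {a : A} :
    (splice m m' 1).mA (s + 1) a = if m.mA 0 a = none then m'.mA s a else m.mA 0 a := by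
  simp [splice]

omit [DecidableEq A] [DecidableEq B] in
theorem splice_one_mB_zero {b : B} : (splice m m' 1).mB 0 b = m.mB 0 b :=
  splice_one_mA_zero (m := m.swap) (m' := m'.swap)

omit [DecidableEq A] [DecidableEq B] in
theorem splice_one_mB_succ {s : ℕ} {b : B} :
    (splice m m' 1).mB (s + 1) b = if m.mB 0 b = none then m'.mB s b else m.mB 0 b :=
  splice_one_mA_succ (m := m.swap) (m' := m'.swap)

omit [DecidableEq A] [DecidableEq B] in
theorem agreeUpTo_splice : agreeUpTo m (splice m m' 1) 1 := by
  intro s hs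
  obtain rfl : s = 0 := by omega
  exact ⟨fun a => splice_one_mA_zero.symm, fun b => splice_one_mB_zero.symm⟩

theorem mA_zero_of_continuation (hD : E.Disj) (hT : 0 < E.T) (hm : IsMatching E m)
    (hm' : IsMatching (contEconomy E m 1) m') {s : ℕ} (hs : s + 1 < E.T) {a : A}
    (h : m'.mA s a ≠ none) : m.mA 0 a = none :=
  ((mem_arrAUpTo_contEconomy hD hm hT).mp
    (hm'.2.1 s a (by change s < E.T - 1; omega) h)).2

theorem IsMatching.splice (hD : E.Disj) (hT : 0 < E.T) (hm : IsMatching E m)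
    (hm' : IsMatching (contEconomy E m 1) m') : IsMatching E (splice m m' 1) := by
  have hTE : (DynMatch.contEconomy E m 1).T = E.T - 1 := rfl
  have aux : ∀ {A B : Type} [DecidableEq A] [DecidableEq B] {E : Economy A B}
      {m m' : PreMatching A B}, E.Disj → 0 < E.T → IsMatching E m →
      IsMatching (DynMatch.contEconomy E m 1) m' → ∀ t a b, t < E.T →
        (DynMatch.splice m m' 1).mA t a = some b → (DynMatch.splice m m' 1).mB t b = some a := by
    intro A B _ _ E m m' hD hT hm hm' t a b ht h
    rcases t with _ | t
    · rw [splice_one_mA_zero] at h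
      rw [splice_one_mB_zero, hm.1 0 a b hT |>.mp h]
    · rw [splice_one_mA_succ] at h
      rw [splice_one_mB_succ]
      split_ifs at h with h0
      · have hb := (hm'.1 t a b (by change t < E.T - 1; omega)).mp h
        rw [if_pos, hb]
        exact mA_zero_of_continuation (E := E.swap) (m := m.swap) (m' := m'.swap)
          hD.swap hT hm.swap hm'.swap ht (by change m'.mB t b ≠ none; simp [hb])
      · have hb := (hm.1 0 a b hT).mp h
        rw [if_neg (by simp [hb]), hb]
  have auxI : ∀ {A B : Type} [DecidableEq A] [DecidableEq B] {E : Economy A B}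
      {m m' : PreMatching A B},
      IsMatching (DynMatch.contEconomy E m 1) m' → ∀ t s a, t ≤ s → s < E.T →
        (DynMatch.splice m m' 1).mA t a ≠ none →
        (DynMatch.splice m m' 1).mA s a = (DynMatch.splice m m' 1).mA t a := by
    intro A B _ _ E m m' hm' t s a hts hs h
    rcases s with _ | s
    · obtain rfl : t = 0 := by omega
      rfl
    rcases t with _ | t
    · rw [splice_one_mA_zero] at h
      rw [splice_one_mA_zero, splice_one_mA_succ, if_neg h]
    · rw [splice_one_mA_succ] at h ⊢
      rw [splice_one_mA_succ]
      split_ifs at h ⊢ with h0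
      · exact hm'.2.2.2.1 t s a (by omega) (by change s < E.T - 1; omega) h
      · rfl
  have auxM : ∀ t a, t < E.T → (DynMatch.splice m m' 1).mA t a ≠ none → a ∈ arrAUpTo E t := by
    intro t a ht h
    rcases t with _ | t
    · rw [splice_one_mA_zero] at h
      exact hm.2.1 0 a hT h
    · rw [splice_one_mA_succ] at h
      split_ifs at h with h0
      · exact ((mem_arrAUpTo_contEconomy hD hm hT).mp (hm'.2.1 t a (by omega) h)).1
      · exact mem_arrAUpTo.mpr ⟨0, by omega, hm.arrA_zero hT h⟩
  refine ⟨fun t a b ht => ⟨aux hD hT hm hm' t a b ht, ?_⟩, auxM, ?_, ?_, ?_⟩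
  · exact aux (E := E.swap) (m := m.swap) (m' := m'.swap) hD.swap hT hm.swap hm'.swap t b a ht
  · intro t a b ht h
    rcases t with _ | t
    · rw [splice_one_mA_zero] at h
      exact hm.2.2.1 0 a b hT h
    · rw [splice_one_mA_succ] at h
      split_ifs at h with h0
      · exact ((mem_arrBUpTo_contEconomy hD hm hT).mp (hm'.2.2.1 t a b (by omega) h)).1
      · obtain ⟨s, hs, hb⟩ := mem_arrBUpTo.mp (hm.2.2.1 0 a b hT h)
        exact mem_arrBUpTo.mpr ⟨s, by omega, hb⟩
  · exact auxI hm'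
  · exact auxI (E := E.swap) (m := m.swap) (m' := m'.swap) hm'.swap

theorem agreeUpTo_restrict_splice (hD : E.Disj) (hT : 0 < E.T) (hm : IsMatching E m)
    (hm' : IsMatching (contEconomy E m 1) m') :
    agreeUpTo m' (restrictM (splice m m' 1) 1) (E.T - 1) := by
  have aux : ∀ {A B : Type} [DecidableEq A] [DecidableEq B] {E : Economy A B}
      {m m' : PreMatching A B}, E.Disj → 0 < E.T → IsMatching E m →
      IsMatching (contEconomy E m 1) m' → ∀ s < E.T - 1, ∀ a,
        m'.mA s a = (restrictM (splice m m' 1) 1).mA s a := by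
    intro A B _ _ E m m' hD hT hm hm' s hs a
    rw [restrictM_one_mA, splice_one_mA_zero, splice_one_mA_succ]
    split_ifs with h0
    · rfl
    · by_contra hne
      exact h0 (mA_zero_of_continuation hD hT hm hm' (by omega) hne)
  exact fun s hs => ⟨aux hD hT hm hm' s hs,
    aux (E := E.swap) (m := m.swap) (m' := m'.swap) hD.swap hT hm.swap hm'.swap s hs⟩

/-! ### Payoffs -/

omit [DecidableEq A] [DecidableEq B] in
/-- Payoffs from a given period onward depend only on the agent's partners in the remaining
periods, up to a shift of time. -/
theorem Upay_congr (P : Pref A B) {E' : Economy A B} {t t' : ℕ} {a : A} (ht : t < E.T)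
    (ht' : t' < E'.T) (hT : E.T - t = E'.T - t')
    (h : ∀ s, t + s < E.T → m.mA (t + s) a = m'.mA (t' + s) a) :
    Upay P E m t a = Upay P E' m' t' a := by
  have hlast : m.mA (E.T - 1) a = m'.mA (E'.T - 1) a := by
    have := h (E.T - 1 - t) (by omega)
    rwa [show t + (E.T - 1 - t) = E.T - 1 by omega,
      show t' + (E.T - 1 - t) = E'.T - 1 by omega] at this
  unfold Upay
  rw [← hlast]
  cases hb : m.mA (E.T - 1) a with
  | none => rfl
  | some b =>
    have hb' : m'.mA (E'.T - 1) a = some b := hlast ▸ hb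
    have aux : ∀ {E E' : Economy A B} {m m' : PreMatching A B} {t t' : ℕ}, t < E.T → t' < E'.T →
        E.T - t = E'.T - t' → (∀ s, t + s < E.T → m.mA (t + s) a = m'.mA (t' + s) a) →
        m.mA (E.T - 1) a = some b → matchTimeA E' m' t' a - t' ≤ matchTimeA E m t a - t := by
      intro E E' m m' t t' ht ht' hT h hb
      have hmem : E.T - 1 ∈ {s | t ≤ s ∧ m.mA s a ≠ none} := ⟨by omega, by simp [hb]⟩
      obtain ⟨h1, h2⟩ := Nat.sInf_mem ⟨_, hmem⟩
      have h3 := Nat.sInf_le hmem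
      unfold matchTimeA
      set N := sInf {s | t ≤ s ∧ m.mA s a ≠ none}
      have h4 : sInf {s | t' ≤ s ∧ m'.mA s a ≠ none} ≤ t' + (N - t) := by
        refine Nat.sInf_le ⟨by omega, ?_⟩
        rw [← h (N - t) (by omega), show t + (N - t) = N by omega]
        exact h2
      omega
    have h1 := aux ht ht' hT h hb
    have h2 := aux ht' ht hT.symm (fun s hs => (h s (by omega)).symm) hb'
    simp only [le_antisymm h1 h2]

theorem finite_payoffs (P : Pref A B) (hT : 0 < E.T) (t : ℕ) (a : A) :
    {x | ∃ m', IsMatching E m' ∧ Upay P E m' t a = x}.Finite := by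
  refine ((((Finset.range (E.T + 1) ×ˢ arrBUpTo E (E.T - 1)).image
    fun p => P.dA a ^ p.1 * P.u a p.2) ∪ {0}).finite_toSet).subset ?_
  rintro x ⟨m', hm', rfl⟩
  rw [Finset.mem_coe, Finset.mem_union, Finset.mem_image, Finset.mem_singleton]
  unfold Upay
  cases hb : m'.mA (E.T - 1) a with
  | none => exact Or.inr rfl
  | some b =>
    refine Or.inl ⟨(matchTimeA E m' t a - t, b), ?_, rfl⟩
    have : matchTimeA E m' t a ≤ E.T := min_le_right _ _
    rw [Finset.mem_product, Finset.mem_range]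
    exact ⟨by dsimp only; omega, hm'.2.2.1 _ a b (by omega) hb⟩

/-! ### Dependence on the history and on the periods of the horizon only -/

omit [DecidableEq A] [DecidableEq B] in
theorem agreeUpTo.symm {t : ℕ} (h : agreeUpTo m m' t) : agreeUpTo m' m t :=
  fun s hs => ⟨fun a => ((h s hs).1 a).symm, fun b => ((h s hs).2 b).symm⟩

omit [DecidableEq A] [DecidableEq B] in
theorem agreeUpTo.trans {m'' : PreMatching A B} {t : ℕ} (h : agreeUpTo m m' t)
    (h' : agreeUpTo m' m'' t) : agreeUpTo m m'' t :=
  fun s hs => ⟨fun a => ((h s hs).1 a).trans ((h' s hs).1 a),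
    fun b => ((h s hs).2 b).trans ((h' s hs).2 b)⟩

omit [DecidableEq A] [DecidableEq B] in
theorem agreeUpTo.mono {s t : ℕ} (h : agreeUpTo m m' t) (hst : s ≤ t) : agreeUpTo m m' s :=
  fun r hr => h r (by omega)

omit [DecidableEq A] [DecidableEq B] in
theorem agreeUpTo.swap {t : ℕ} (h : agreeUpTo m m' t) : agreeUpTo m.swap m'.swap t :=
  fun s hs => ⟨(h s hs).2, (h s hs).1⟩

omit [DecidableEq B] in
theorem availA_congr {t : ℕ} (h : agreeUpTo m m' t) : availA E m t = availA E m' t := by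
  ext a
  simp only [mem_availA]
  exact and_congr_right fun _ => forall₂_congr fun s hs => by rw [(h s hs).1 a]

omit [DecidableEq A] in
theorem availB_congr {t : ℕ} (h : agreeUpTo m m' t) : availB E m t = availB E m' t :=
  availA_congr (E := E.swap) h.swap

theorem contEconomy_congr {t : ℕ} (h : agreeUpTo m m' t) :
    contEconomy E m t = contEconomy E m' t := by
  simp only [contEconomy, availA_congr h, availB_congr h]

omit [DecidableEq A] [DecidableEq B] in
theorem agreeUpTo.restrict {t T : ℕ} (ht : t ≤ T) (h : agreeUpTo m m' T) :
    agreeUpTo (restrictM m t) (restrictM m' t) (T - t) := by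
  have aux : ∀ {A B : Type} {m m' : PreMatching A B}, agreeUpTo m m' T →
      ∀ s < T - t, ∀ a, (restrictM m t).mA s a = (restrictM m' t).mA s a := by
    intro A B m m' h s hs a
    have key : (∀ s', s' < t → m.mA s' a = none) ↔ ∀ s', s' < t → m'.mA s' a = none :=
      forall₂_congr fun s hs => by rw [(h s (by omega)).1 a]
    simp only [restrictM, key, (h (t + s) (by omega)).1 a]
  exact fun s hs => ⟨aux h s hs, aux h.swap s hs⟩

theorem IsMatching.congr (h : agreeUpTo m m' E.T) (hm : IsMatching E m) : IsMatching E m' := by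
  obtain ⟨h1, h2, h3, h4, h5⟩ := hm
  refine ⟨?_, ?_, ?_, ?_, ?_⟩
  · intro t a b ht
    rw [← (h t ht).1, ← (h t ht).2]
    exact h1 t a b ht
  · intro t a ht
    rw [← (h t ht).1]
    exact h2 t a ht
  · intro t a b ht
    rw [← (h t ht).1]
    exact h3 t a b ht
  · intro t s a hts hs
    rw [← (h s hs).1, ← (h t (by omega)).1]
    exact h4 t s a hts hs
  · intro t s b hts hs
    rw [← (h s hs).2, ← (h t (by omega)).2]
    exact h5 t s b hts hs

omit [DecidableEq A] [DecidableEq B] in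
theorem Upay_congr_horizon (P : Pref A B) {t : ℕ} (ht : t < E.T) (h : agreeUpTo m m' E.T) (a : A) :
    Upay P E m t a = Upay P E m' t a :=
  Upay_congr P ht ht rfl fun s hs => (h (t + s) hs).1 a

omit [DecidableEq A] [DecidableEq B] in
theorem Vpay_congr_horizon (P : Pref A B) {t : ℕ} (ht : t < E.T) (h : agreeUpTo m m' E.T) (b : B) :
    Vpay P E m t b = Vpay P E m' t b :=
  Upay_congr_horizon (E := E.swap) P.swap ht h.swap b

theorem MSetH_congr {t : ℕ} (h : agreeUpTo m m' t) : MSetH E m t = MSetH E m' t := by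
  ext x
  exact and_congr_right fun _ => ⟨h.symm.trans, h.trans⟩

theorem MSet_congr {t : ℕ} (h : agreeUpTo m m' t) (k : Agent A B) :
    MSet E m t k = MSet E m' t k := by
  ext x
  exact and_congr_right fun _ => and_congr_left fun _ => ⟨h.symm.trans, h.trans⟩

section

variable {P : Pref A B} {SDS : Economy A B → Set (PreMatching A B)}

theorem sdsF_congr {t : ℕ} (h : agreeUpTo m m' t) (n : ℕ) :
    sdsF P SDS E t m n = sdsF P SDS E t m' n := by
  induction n with
  | zero =>
    funext k
    simp only [sdsF, MSet_congr h, contEconomy_congr h]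
  | succ n ih =>
    funext k
    simp only [sdsF, ih, candT, MSetH_congr h, StableInduced, availA_congr h, availB_congr h]

theorem sdsConj_congr {t : ℕ} (h : agreeUpTo m m' t) :
    sdsConj P SDS E t m = sdsConj P SDS E t m' := by
  funext k
  simp only [sdsConj, sdsF_congr h]

theorem IsSolution.congr (h : agreeUpTo m m' E.T) (hm : IsSolution P E (sdsConj P SDS E) m) :
    IsSolution P E (sdsConj P SDS E) m' := by
  refine ⟨hm.1.congr h, fun t ht => ?_⟩
  have := hm.2 t ht
  simpa only [availA_congr (h.mono ht.le), availB_congr (h.mono ht.le),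
    sdsConj_congr (h.mono ht.le), Upay_congr_horizon P ht h, Vpay_congr_horizon P ht h] using this

theorem Stable1.congr (hT : 0 < E.T) (h : agreeUpTo m m' E.T) (hm : Stable1 P E m) :
    Stable1 P E m' := by
  refine ⟨hm.1.congr h, ?_⟩
  simpa only [(h (E.T - 1) (by omega)).1, (h (E.T - 1) (by omega)).2,
    Upay_congr_horizon P hT h, Vpay_congr_horizon P hT h] using hm.2

theorem IsSDSFamily.congr (hS : IsSDSFamily P SDS) (h : agreeUpTo m m' E.T) (hm : m ∈ SDS E) :
    m' ∈ SDS E := by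
  obtain h0 | h1 | h2 : E.T = 0 ∨ E.T = 1 ∨ 2 ≤ E.T := by omega
  · rw [hS.1 E h0]; trivial
  · rw [hS.2.1 E h1] at hm ⊢
    exact Stable1.congr (by omega) h hm
  · rw [hS.2.2 E h2] at hm ⊢
    exact IsSolution.congr h hm

theorem IsSDSFamily.isMatching (hS : IsSDSFamily P SDS) (hm : m ∈ SDS E) : IsMatching E m := by
  obtain h0 | h1 | h2 : E.T = 0 ∨ E.T = 1 ∨ 2 ≤ E.T := by omega
  · refine ⟨?_, ?_, ?_, ?_, ?_⟩ <;> intros <;> omega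
  · rw [hS.2.1 E h1] at hm
    exact hm.1
  · rw [hS.2.2 E h2] at hm
    exact hm.1

omit [DecidableEq A] [DecidableEq B] in
theorem agreeUpTo.unmatchedThrough {t T : ℕ} (ht : t < T) (h : agreeUpTo m m' T)
    {k : Agent A B} (hk : unmatchedThrough m t k) : unmatchedThrough m' t k := by
  cases k with
  | inl a => exact fun s hs => ((h s (by omega)).1 a).symm.trans (hk s hs)
  | inr b => exact fun s hs => ((h s (by omega)).2 b).symm.trans (hk s hs)

theorem agreeUpTo.mem_sdsF (hS : IsSDSFamily P SDS) {t : ℕ} (ht : t < E.T)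
    {x y : PreMatching A B} (h : agreeUpTo x y E.T) {n : ℕ} {k : Agent A B}
    (hx : x ∈ sdsF P SDS E t m n k) : y ∈ sdsF P SDS E t m n k := by
  induction n with
  | zero =>
    obtain ⟨⟨h1, h2, h3⟩, h4⟩ := hx
    refine ⟨⟨h1.congr h, h2.trans (h.mono ht.le), h.unmatchedThrough ht h3⟩, hS.congr ?_ h4⟩
    have hT : (delayEconomy (contEconomy E m t) k).T = E.T - t := by cases k <;> rfl
    rw [hT]
    exact h.restrict ht.le
  | succ n ih =>
    refine hx.imp ih ?_
    rintro ⟨⟨⟨h1, h2⟩, h3, h4⟩, h5⟩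
    refine ⟨⟨⟨h1.congr h, h2.trans (h.mono ht.le)⟩, ?_, ?_⟩, ?_⟩
    · simpa only [StableInduced, (h t ht).1, (h t ht).2] using h3
    · rw [← contEconomy_congr (h.mono ht)]
      exact hS.congr (h.restrict ht) h4
    · cases k with
      | inl a => exact ((h t ht).1 a).symm.trans h5
      | inr b => exact ((h t ht).2 b).symm.trans h5

end

/-! ### Conjectures of a continuation economy -/

section

variable {P : Pref A B} {SDS : Economy A B → Set (PreMatching A B)}

omit [DecidableEq A] [DecidableEq B] in
theorem restrictM_one_mA_of_agree {x : PreMatching A B} (hx : agreeUpTo m x 1) {a : A}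
    (ha : m.mA 0 a = none) (s : ℕ) : (restrictM x 1).mA s a = x.mA (s + 1) a := by
  rw [restrictM_one_mA, if_pos (((hx 0 one_pos).1 a).symm.trans ha)]

omit [DecidableEq A] [DecidableEq B] in
theorem restrictM_one_mB_of_agree {x : PreMatching A B} (hx : agreeUpTo m x 1) {b : B}
    (hb : m.mB 0 b = none) (s : ℕ) : (restrictM x 1).mB s b = x.mB (s + 1) b :=
  restrictM_one_mA_of_agree hx.swap hb s

omit [DecidableEq B] in
theorem mA_zero_of_mem_availA {t : ℕ} {a : A} (ha : a ∈ availA E m (t + 1)) : m.mA 0 a = none :=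
  (mem_availA.mp ha).2 0 (Nat.succ_pos t)

omit [DecidableEq A] in
theorem mB_zero_of_mem_availB {t : ℕ} {b : B} (hb : b ∈ availB E m (t + 1)) : m.mB 0 b = none :=
  (mem_availB.mp hb).2 0 (Nat.succ_pos t)

theorem Upay_restrictM (P : Pref A B) {t : ℕ} (ht : t + 1 < E.T) {x : PreMatching A B}
    (hx : agreeUpTo m x 1) {a : A} (ha : m.mA 0 a = none) :
    Upay P E x (t + 1) a = Upay P (contEconomy E m 1) (restrictM x 1) t a := by
  have hT : (contEconomy E m 1).T = E.T - 1 := rfl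
  refine Upay_congr P ht (by omega) (by omega) fun s _ => ?_
  rw [restrictM_one_mA_of_agree hx ha, add_right_comm]

theorem Vpay_restrictM (P : Pref A B) {t : ℕ} (ht : t + 1 < E.T) {x : PreMatching A B}
    (hx : agreeUpTo m x 1) {b : B} (hb : m.mB 0 b = none) :
    Vpay P E x (t + 1) b = Vpay P (contEconomy E m 1) (restrictM x 1) t b :=
  Upay_restrictM (E := E.swap) P.swap ht hx.swap hb

theorem agreeUpTo_succ_iff {x : PreMatching A B} {t : ℕ} (ht : t < E.T) (hm : IsMatching E m)
    (hx : IsMatching E x) (h : agreeUpTo m x 1) :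
    agreeUpTo m x (t + 1) ↔ agreeUpTo (restrictM m 1) (restrictM x 1) t := by
  refine ⟨fun h => h.restrict (by omega), fun h' => ?_⟩
  have aux : ∀ {A B : Type} [DecidableEq A] [DecidableEq B] {E : Economy A B}
      {m x : PreMatching A B}, t < E.T → IsMatching E m → IsMatching E x → agreeUpTo m x 1 →
      agreeUpTo (restrictM m 1) (restrictM x 1) t → ∀ s < t + 1, ∀ a, m.mA s a = x.mA s a := by
    intro A B _ _ E m x ht hm hx h h' s hs a
    have h0 := (h 0 one_pos).1 a
    rcases s with _ | s
    · exact h0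
    by_cases hn : m.mA 0 a = none
    · have := (h' s (by omega)).1 a
      rwa [restrictM_one_mA, restrictM_one_mA, ← h0, if_pos hn, if_pos hn] at this
    · rw [hm.2.2.2.1 0 (s + 1) a (by omega) (by omega) hn,
        hx.2.2.2.1 0 (s + 1) a (by omega) (by omega) (h0 ▸ hn), h0]
  exact fun s hs => ⟨aux ht hm hx h h' s hs,
    aux (E := E.swap) (m := m.swap) (x := x.swap) ht hm.swap hx.swap h.swap h'.swap s hs⟩

theorem unmatchedThrough_succ_iff {x : PreMatching A B} {t : ℕ} (h : agreeUpTo m x 1)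
    {k : Agent A B} (hk : isAvail E m (t + 1) k) :
    unmatchedThrough x (t + 1) k ↔ unmatchedThrough (restrictM x 1) t k := by
  cases k with
  | inl a =>
    have h0 := mA_zero_of_mem_availA hk
    have h1 := ((h 0 one_pos).1 a).symm.trans h0
    constructor
    · intro hu s hs
      rw [restrictM_one_mA_of_agree h h0]
      exact hu (s + 1) (by omega)
    · rintro hu (_ | s) hs
      · exact h1
      · rw [← restrictM_one_mA_of_agree h h0]
        exact hu s (by omega)
  | inr b =>
    have h0 := mB_zero_of_mem_availB hk
    have h1 := ((h 0 one_pos).2 b).symm.trans h0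
    constructor
    · intro hu s hs
      rw [restrictM_one_mB_of_agree h h0]
      exact hu (s + 1) (by omega)
    · rintro hu (_ | s) hs
      · exact h1
      · rw [← restrictM_one_mB_of_agree h h0]
        exact hu s (by omega)

theorem unmatchedAt_succ_iff {x : PreMatching A B} {t : ℕ} (h : agreeUpTo m x 1)
    {k : Agent A B} (hk : isAvail E m (t + 1) k) :
    unmatchedAt x (t + 1) k ↔ unmatchedAt (restrictM x 1) t k := by
  cases k with
  | inl a =>
    simp only [unmatchedAt, restrictM_one_mA_of_agree h (mA_zero_of_mem_availA hk)]
  | inr b =>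
    simp only [unmatchedAt, restrictM_one_mB_of_agree h (mB_zero_of_mem_availB hk)]

theorem mem_MSetH_of_mem_sdsF {t n : ℕ} {k : Agent A B} {x : PreMatching A B}
    (hx : x ∈ sdsF P SDS E t m n k) : x ∈ MSetH E m t := by
  induction n with
  | zero => exact ⟨hx.1.1, hx.1.2.1⟩
  | succ n ih => exact hx.elim ih fun h => h.1.1

omit [DecidableEq A] [DecidableEq B] in
theorem indU_congr {W W' : A → ℝ} {a : A} (h : W a = W' a) (o : Option B) :
    indU P W a o = indU P W' a o := by
  cases o
  · exact h
  · rfl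

omit [DecidableEq A] [DecidableEq B] in
theorem indV_congr {W W' : B → ℝ} {b : B} (h : W b = W' b) (o : Option A) :
    indV P W b o = indV P W' b o := by
  cases o
  · exact h
  · rfl

theorem StableInduced_succ_iff (hD : E.Disj) (hm : IsMatching E m) (hT : 0 < E.T)
    {t : ℕ} {C C' : Agent A B → Set (PreMatching A B)}
    (hA : ∀ a ∈ availA E m (t + 1), wA P E (t + 1) C a = wA P (contEconomy E m 1) t C' a)
    (hB : ∀ b ∈ availB E m (t + 1), wB P E (t + 1) C b = wB P (contEconomy E m 1) t C' b)
    {x : PreMatching A B} (hx : agreeUpTo m x 1) :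
    StableInduced P E m (t + 1) C x ↔
      StableInduced P (contEconomy E m 1) (restrictM m 1) t C' (restrictM x 1) := by
  have eA : ∀ a ∈ availA E m (t + 1), (restrictM x 1).mA t a = x.mA (t + 1) a :=
    fun a ha => restrictM_one_mA_of_agree hx (mA_zero_of_mem_availA ha) t
  have eB : ∀ b ∈ availB E m (t + 1), (restrictM x 1).mB t b = x.mB (t + 1) b :=
    fun b hb => restrictM_one_mB_of_agree hx (mB_zero_of_mem_availB hb) t
  unfold StableInduced
  rw [availA_contEconomy hD hm hT, availB_contEconomy hD hm hT]
  refine and_congr ?_ (and_congr ?_ (and_congr ?_ (and_congr ?_ ?_)))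
  · refine forall₂_congr fun a ha => forall_congr' fun b => ?_
    rw [eA a ha]
    exact imp_congr_right fun _ => and_congr_right fun hb => by rw [eB b hb]
  · refine forall₂_congr fun b hb => forall_congr' fun a => ?_
    rw [eB b hb]
    exact imp_congr_right fun _ => and_congr_right fun ha => by rw [eA a ha]
  · exact forall₂_congr fun a ha => by rw [eA a ha, hA a ha]
  · exact forall₂_congr fun b hb => by rw [eB b hb, hB b hb]
  · exact forall₂_congr fun a ha => forall₂_congr fun b hb => by
      rw [eA a ha, eB b hb, indU_congr (hA a ha), indV_congr (hB b hb)]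

theorem image_sdsF_eq (hS : IsSDSFamily P SDS) (hD : E.Disj) (hm : IsMatching E m) {t n : ℕ}
    (ht : t + 1 < E.T) {k : Agent A B}
    (hk : ∀ x, IsMatching E x → agreeUpTo m x 1 → (x ∈ sdsF P SDS E (t + 1) m n k ↔
      restrictM x 1 ∈ sdsF P SDS (contEconomy E m 1) t (restrictM m 1) n k))
    {f g : PreMatching A B → ℝ} (hfg : ∀ x, agreeUpTo m x 1 → f x = g (restrictM x 1))
    (hg : ∀ x y, agreeUpTo x y (E.T - 1) → g x = g y) :
    f '' sdsF P SDS E (t + 1) m n k =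
      g '' sdsF P SDS (contEconomy E m 1) t (restrictM m 1) n k := by
  have hT : 0 < E.T := by omega
  have ht' : t < (contEconomy E m 1).T := by change t < E.T - 1; omega
  ext r
  constructor
  · rintro ⟨x, hx, rfl⟩
    obtain ⟨hx1, hx2⟩ := mem_MSetH_of_mem_sdsF hx
    have hx3 := hx2.mono (Nat.succ_le_succ (Nat.zero_le t))
    exact ⟨restrictM x 1, (hk x hx1 hx3).mp hx, (hfg x hx3).symm⟩
  · rintro ⟨y, hy, rfl⟩
    have hy1 := (mem_MSetH_of_mem_sdsF hy).1
    have hagree := agreeUpTo_restrict_splice hD hT hm hy1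
    refine ⟨splice m y 1, (hk _ (hm.splice hD hT hy1) agreeUpTo_splice).mpr
      (agreeUpTo.mem_sdsF hS ht' hagree hy), ?_⟩
    rw [hfg _ agreeUpTo_splice, hg _ _ hagree]

theorem mem_sdsF_succ_iff (hS : IsSDSFamily P SDS) (hD : E.Disj) (hm : IsMatching E m) {t : ℕ}
    (ht : t + 1 < E.T) (n : ℕ) : ∀ k, isAvail E m (t + 1) k →
      ∀ x, IsMatching E x → agreeUpTo m x 1 → (x ∈ sdsF P SDS E (t + 1) m n k ↔
        restrictM x 1 ∈ sdsF P SDS (contEconomy E m 1) t (restrictM m 1) n k) := by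
  have hT : 0 < E.T := by omega
  have ht' : t < (contEconomy E m 1).T := by change t < E.T - 1; omega
  have hM : ∀ x, IsMatching E x → agreeUpTo m x 1 →
      IsMatching (contEconomy E m 1) (restrictM x 1) := fun x hx h => by
    rw [contEconomy_congr h]; exact hx.restrict hD hT
  induction n with
  | zero =>
    intro k hk x hx h
    simp only [sdsF, MSet, Set.mem_ofPred_eq]
    rw [agreeUpTo_succ_iff (by omega) hm hx h, unmatchedThrough_succ_iff h hk,
      contEconomy_contEconomy hD hm hT, restrictM_restrictM]
    simp only [hx, hM x hx h]
  | succ n ih =>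
    intro k hk x hx h
    have hA : ∀ a ∈ availA E m (t + 1), wA P E (t + 1) (sdsF P SDS E (t + 1) m n) a =
        wA P (contEconomy E m 1) t (sdsF P SDS (contEconomy E m 1) t (restrictM m 1) n) a :=
      fun a ha => congrArg sInf (image_sdsF_eq hS hD hm ht (ih (Sum.inl a) ha)
        (fun x hx => Upay_restrictM P ht hx (mA_zero_of_mem_availA ha))
        (fun x y hxy => Upay_congr_horizon P ht' hxy a))
    have hB : ∀ b ∈ availB E m (t + 1), wB P E (t + 1) (sdsF P SDS E (t + 1) m n) b =
        wB P (contEconomy E m 1) t (sdsF P SDS (contEconomy E m 1) t (restrictM m 1) n) b :=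
      fun b hb => congrArg sInf (image_sdsF_eq hS hD hm ht (ih (Sum.inr b) hb)
        (fun x hx => Vpay_restrictM P ht hx (mB_zero_of_mem_availB hb))
        (fun x y hxy => Vpay_congr_horizon P ht' hxy b))
    refine or_congr (ih k hk x hx h) ?_
    simp only [candT, MSetH, Set.mem_ofPred_eq]
    rw [agreeUpTo_succ_iff (by omega) hm hx h, unmatchedAt_succ_iff h hk,
      StableInduced_succ_iff hD hm hT hA hB h, contEconomy_congr h,
      contEconomy_contEconomy hD hx hT, restrictM_restrictM]
    have := hM x hx h
    rw [contEconomy_congr h] at this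
    simp only [hx, this]

/-- A solution of the continuation economy gives the conditions of a solution of the whole
economy in all periods but the first. -/
theorem IsSolution.of_contEconomy (hS : IsSDSFamily P SDS) (hD : E.Disj) (hm : IsMatching E m)
    (h : IsSolution P (contEconomy E m 1) (sdsConj P SDS (contEconomy E m 1)) (restrictM m 1))
    {t : ℕ} (ht : t + 1 < E.T) :
    ((∀ a ∈ availA E m (t + 1), ∃ m' ∈ sdsConj P SDS E (t + 1) m (Sum.inl a),
      Upay P E m' (t + 1) a ≤ Upay P E m (t + 1) a) ∧
     (∀ b ∈ availB E m (t + 1), ∃ m' ∈ sdsConj P SDS E (t + 1) m (Sum.inr b),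
      Vpay P E m' (t + 1) b ≤ Vpay P E m (t + 1) b) ∧
     (∀ a ∈ availA E m (t + 1), ∀ b ∈ availB E m (t + 1),
        ¬(P.u a b > Upay P E m (t + 1) a ∧ P.v a b > Vpay P E m (t + 1) b))) := by
  have hT : 0 < E.T := by omega
  have ht' : t < (contEconomy E m 1).T := by change t < E.T - 1; omega
  have hr : agreeUpTo m m 1 := fun _ _ => ⟨fun _ => rfl, fun _ => rfl⟩
  obtain ⟨h1, h2, h3⟩ := h.2 t ht'
  rw [availA_contEconomy hD hm hT, availB_contEconomy hD hm hT] at *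
  refine ⟨fun a ha => ?_, fun b hb => ?_, fun a ha b hb => ?_⟩
  · obtain ⟨y, hy, hle⟩ := h1 a ha
    obtain ⟨n, hn⟩ := Set.mem_iUnion.mp hy
    obtain ⟨x, hx, hxy⟩ := (image_sdsF_eq hS hD hm ht (mem_sdsF_succ_iff hS hD hm ht n
      (Sum.inl a) ha) (fun x hx => Upay_restrictM P ht hx (mA_zero_of_mem_availA ha))
      (fun x y hxy => Upay_congr_horizon P ht' hxy a)).symm.subset ⟨y, hn, rfl⟩
    refine ⟨x, Set.mem_iUnion.mpr ⟨n, hx⟩, ?_⟩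
    rw [Upay_restrictM P ht hr (mA_zero_of_mem_availA ha)]
    exact hxy.trans_le hle
  · obtain ⟨y, hy, hle⟩ := h2 b hb
    obtain ⟨n, hn⟩ := Set.mem_iUnion.mp hy
    obtain ⟨x, hx, hxy⟩ := (image_sdsF_eq hS hD hm ht (mem_sdsF_succ_iff hS hD hm ht n
      (Sum.inr b) hb) (fun x hx => Vpay_restrictM P ht hx (mB_zero_of_mem_availB hb))
      (fun x y hxy => Vpay_congr_horizon P ht' hxy b)).symm.subset ⟨y, hn, rfl⟩
    refine ⟨x, Set.mem_iUnion.mpr ⟨n, hx⟩, ?_⟩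
    rw [Vpay_restrictM P ht hr (mB_zero_of_mem_availB hb)]
    exact hxy.trans_le hle
  · rw [Upay_restrictM P ht hr (mA_zero_of_mem_availA ha),
      Vpay_restrictM P ht hr (mB_zero_of_mem_availB hb)]
    exact h3 a ha b hb

end

/-! ### Static stable matchings with outside options -/

/-- Existence of stable matchings in a one-period economy with outside options. -/
theorem exists_stable_pairs {A B : Type} (A₀ : Finset A) (B₀ : Finset B) (u v : A → B → ℝ)
    (w : A → ℝ) (z : B → ℝ) :
    ∃ M : Finset (A × B), M ⊆ A₀ ×ˢ B₀ ∧
      (∀ a b b', (a, b) ∈ M → (a, b') ∈ M → b = b') ∧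
      (∀ a a' b, (a, b) ∈ M → (a', b) ∈ M → a = a') ∧
      (∀ a b, (a, b) ∈ M → w a ≤ u a b ∧ z b ≤ v a b) ∧
      ∀ a ∈ A₀, ∀ b ∈ B₀, ¬(w a < u a b ∧ z b < v a b ∧
        (∀ b', (a, b') ∈ M → u a b' < u a b) ∧ ∀ a', (a', b) ∈ M → v a' b < v a b) := by
  let Blocks : Finset (A × B) → A → B → Prop := fun M a b => w a < u a b ∧ z b < v a b ∧
    (∀ b', (a, b') ∈ M → u a b' < u a b) ∧ ∀ a', (a', b) ∈ M → v a' b < v a b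
  -- Maximize the surplus of side `B` among matchings all of whose blocking pairs involve
  -- an unmatched agent of side `A`.
  let Good : Finset (A × B) → Prop := fun M =>
      (∀ a b b', (a, b) ∈ M → (a, b') ∈ M → b = b') ∧
      (∀ a a' b, (a, b) ∈ M → (a', b) ∈ M → a = a') ∧
      (∀ a b, (a, b) ∈ M → w a ≤ u a b ∧ z b ≤ v a b) ∧
      ∀ a ∈ A₀, ∀ b ∈ B₀, Blocks M a b → ∀ b', (a, b') ∉ M
  let surplus : Finset (A × B) → ℝ := fun M => ∑ p ∈ M, (v p.1 p.2 - z p.2)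
  obtain ⟨M, hM, hmax⟩ := ((A₀ ×ˢ B₀).powerset.filter Good).exists_max_image surplus
    ⟨∅, by simp [Good]⟩
  rw [Finset.mem_filter, Finset.mem_powerset] at hM
  obtain ⟨hsub, huA, huB, hIR, hq⟩ := hM
  refine ⟨M, hsub, huA, huB, hIR, fun a ha b₀ hb₀ hblock₀ => ?_⟩
  obtain ⟨b, hb, hbmax⟩ := (B₀.filter (Blocks M a)).exists_max_image (u a)
    ⟨b₀, Finset.mem_filter.mpr ⟨hb₀, hblock₀⟩⟩
  rw [Finset.mem_filter] at hb
  obtain ⟨hbB, hblock⟩ := hb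
  have hsingle := hq a ha b hbB hblock
  set M' : Finset (A × B) := insert (a, b) (M.filter fun p => p.2 ≠ b) with hM'
  have hmem : ∀ x y, (x, y) ∈ M' ↔ (x = a ∧ y = b) ∨ ((x, y) ∈ M ∧ y ≠ b) := by
    intro x y
    rw [hM', Finset.mem_insert, Finset.mem_filter, Prod.mk.injEq]
  have hgood : Good M' := by
    refine ⟨fun x y y' h h' => ?_, fun x x' y h h' => ?_, fun x y h => ?_,
      fun x hx y hy hbl y' h => ?_⟩
    · rw [hmem] at h h'
      rcases h with ⟨rfl, rfl⟩ | ⟨h, -⟩ <;> rcases h' with ⟨hx, rfl⟩ | ⟨h', -⟩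
      · rfl
      · exact absurd h' (hsingle y')
      · subst hx; exact absurd h (hsingle y)
      · exact huA x y y' h h'
    · rw [hmem] at h h'
      rcases h with ⟨rfl, rfl⟩ | ⟨h, hy⟩ <;> rcases h' with ⟨hx, hy'⟩ | ⟨h', hy'⟩
      · exact hx.symm
      · exact absurd rfl hy'
      · exact absurd hy' hy
      · exact huB x x' y h h'
    · rw [hmem] at h
      rcases h with ⟨rfl, rfl⟩ | ⟨h, -⟩
      · exact ⟨hblock.1.le, hblock.2.1.le⟩
      · exact hIR x y h
    · have hv : ∀ x', (x', y) ∈ M → v x' y < v x y := by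
        intro x' hx'
        by_cases hyb : y = b
        · subst hyb
          exact (hblock.2.2.2 x' hx').trans
            (hbl.2.2.2 a ((hmem a y).mpr (Or.inl ⟨rfl, rfl⟩)))
        · exact hbl.2.2.2 x' ((hmem x' y).mpr (Or.inr ⟨hx', hyb⟩))
      rcases (hmem x y').mp h with ⟨rfl, rfl⟩ | ⟨h', hy'⟩
      · have h1 : Blocks M x y :=
          ⟨hbl.1, hbl.2.1, fun c hc => absurd hc (hsingle c), hv⟩
        have h2 := hbmax y (Finset.mem_filter.mpr ⟨hy, h1⟩)
        exact absurd (hbl.2.2.1 y' h) (not_lt.mpr h2)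
      · refine hq x hx y hy ⟨hbl.1, hbl.2.1, fun c hc => ?_, hv⟩ y' h'
        rw [huA x c y' hc h']
        exact hbl.2.2.1 y' h
  have hsub' : M' ⊆ A₀ ×ˢ B₀ := by
    rintro ⟨x, y⟩ h
    rcases (hmem x y).mp h with ⟨rfl, rfl⟩ | ⟨h, -⟩
    · exact Finset.mem_product.mpr ⟨ha, hbB⟩
    · exact hsub h
  have hle := hmax M' (Finset.mem_filter.mpr ⟨Finset.mem_powerset.mpr hsub', hgood⟩)
  have h1 : surplus M' = (v a b - z b) + surplus (M.filter fun p => p.2 ≠ b) := by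
    simp only [surplus, hM']
    rw [Finset.sum_insert (by simp)]
  have h2 : surplus M = surplus (M.filter fun p => p.2 = b) +
      surplus (M.filter fun p => p.2 ≠ b) :=
    (Finset.sum_filter_add_sum_filter_not M _ _).symm
  have h3 : surplus (M.filter fun p => p.2 = b) < v a b - z b := by
    by_cases hex : ∃ a', (a', b) ∈ M
    · obtain ⟨a', ha'⟩ := hex
      have : M.filter (fun p => p.2 = b) = {(a', b)} := by
        ext ⟨x, y⟩
        rw [Finset.mem_filter, Finset.mem_singleton, Prod.mk.injEq]
        constructor
        · rintro ⟨h, rfl⟩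
          exact ⟨huB _ _ _ h ha', rfl⟩
        · rintro ⟨rfl, rfl⟩
          exact ⟨ha', rfl⟩
      have hlt := hblock.2.2.2 a' ha'
      simp only [surplus, this, Finset.sum_singleton]
      linarith
    · have : M.filter (fun p => p.2 = b) = ∅ := by
        refine Finset.filter_eq_empty_iff.mpr ?_
        rintro ⟨x, y⟩ h rfl
        exact hex ⟨x, h⟩
      have hlt := hblock.2.1
      simp only [surplus, this, Finset.sum_empty]
      linarith
  linarith

/-- The time-independent matching given by a set of disjoint pairs. -/
theorem exists_matching_of_pairs {M : Finset (A × B)} (hM : M ⊆ E.arrA 0 ×ˢ E.arrB 0)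
    (hA : ∀ a b b', (a, b) ∈ M → (a, b') ∈ M → b = b')
    (hB : ∀ a a' b, (a, b) ∈ M → (a', b) ∈ M → a = a') :
    ∃ m, IsMatching E m ∧ (∀ a b, m.mA 0 a = some b ↔ (a, b) ∈ M) ∧
      ∀ a b, m.mB 0 b = some a ↔ (a, b) ∈ M := by
  have key : ∀ {X Y : Type} (R : X → Y → Prop), (∀ x y y', R x y → R x y' → y = y') →
      ∃ f : X → Option Y, ∀ x y, f x = some y ↔ R x y := by
    intro X Y R hR
    refine ⟨fun x => if h : ∃ y, R x y then some h.choose else none, fun x y => ?_⟩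
    beta_reduce
    by_cases h : ∃ y, R x y
    · rw [dif_pos h, Option.some_inj]
      exact ⟨fun e => e ▸ h.choose_spec, fun hy => hR _ _ _ h.choose_spec hy⟩
    · rw [dif_neg h]
      exact ⟨fun e => by simp at e, fun hy => absurd ⟨y, hy⟩ h⟩
  obtain ⟨f, hf⟩ := key (fun a b => (a, b) ∈ M) hA
  obtain ⟨g, hg⟩ := key (fun b a => (a, b) ∈ M) fun b a a' h h' => hB a a' b h h'
  refine ⟨⟨fun _ => f, fun _ => g⟩, ⟨?_, ?_, ?_, ?_, ?_⟩, hf, fun a b => hg b a⟩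
  · exact fun t a b _ => (hf a b).trans (hg b a).symm
  · intro t a _ h
    obtain ⟨b, hb⟩ := Option.ne_none_iff_exists'.mp h
    exact mem_arrAUpTo.mpr ⟨0, t.zero_le, (Finset.mem_product.mp (hM ((hf a b).mp hb))).1⟩
  · intro t a b _ h
    exact mem_arrBUpTo.mpr ⟨0, t.zero_le, (Finset.mem_product.mp (hM ((hf a b).mp h))).2⟩
  · exact fun _ _ _ _ _ _ => rfl
  · exact fun _ _ _ _ _ _ => rfl

/-! ### Existence -/

/-- Along an increasing sequence of sets on whose union a real function takes finitely many
values, the infima are eventually the minimum over the union. -/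
theorem exists_isLeast_sInf_image {X : Type*} {S : ℕ → Set X} (hS : Monotone S) (f : X → ℝ)
    (hne : (S 0).Nonempty) (hfin : (f '' ⋃ n, S n).Finite) :
    ∃ N, ∀ n ≥ N, IsLeast (f '' ⋃ n, S n) (sInf (f '' S n)) := by
  have hne' : (f '' ⋃ n, S n).Nonempty := (hne.mono (Set.subset_iUnion S 0)).image f
  obtain ⟨r, ⟨x, hx, rfl⟩, hmin⟩ := Set.exists_min_image _ id hfin hne'
  obtain ⟨N, hN⟩ := Set.mem_iUnion.mp hx
  refine ⟨N, fun n hn => ?_⟩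
  have h : IsLeast (f '' S n) (f x) :=
    ⟨⟨x, hS hn hN, rfl⟩, fun r hr => hmin r (Set.image_mono (Set.subset_iUnion S n) hr)⟩
  rw [h.csInf_eq]
  exact ⟨⟨x, hx, rfl⟩, hmin⟩

section

variable {P : Pref A B} {SDS : Economy A B → Set (PreMatching A B)}

theorem monotone_sdsF {t : ℕ} (k : Agent A B) : Monotone fun n => sdsF P SDS E t m n k :=
  monotone_nat_of_le_succ fun _ => Set.subset_union_left

theorem Upay_of_matched (P : Pref A B) (hm : IsMatching E m) {t : ℕ} (ht : t < E.T) {a : A}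
    {b : B} (h : m.mA t a = some b) : Upay P E m t a = P.u a b := by
  have hlast : m.mA (E.T - 1) a = some b := by
    rw [← h]
    exact hm.2.2.2.1 t (E.T - 1) a (by omega) (by omega) (by simp [h])
  have htime : matchTimeA E m t a - t = 0 := by
    have : sInf {s | t ≤ s ∧ m.mA s a ≠ none} ≤ t := Nat.sInf_le ⟨le_rfl, by simp [h]⟩
    unfold matchTimeA
    omega
  unfold Upay
  rw [hlast]
  simp only [htime, pow_zero, one_mul]

theorem Vpay_of_matched (P : Pref A B) (hm : IsMatching E m) {t : ℕ} (ht : t < E.T) {a : A}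
    {b : B} (h : m.mB t b = some a) : Vpay P E m t b = P.v a b :=
  Upay_of_matched P.swap hm.swap ht h

theorem exists_isLeast_wA (hT : 0 < E.T) {t : ℕ} {a : A}
    (hne : (sdsF P SDS E t m 0 (Sum.inl a)).Nonempty) :
    ∃ N, ∀ n ≥ N, IsLeast ((fun x => Upay P E x t a) '' sdsConj P SDS E t m (Sum.inl a))
      (wA P E t (sdsF P SDS E t m n) a) := by
  refine exists_isLeast_sInf_image (monotone_sdsF (Sum.inl a)) _ hne
    ((finite_payoffs P hT t a).subset ?_)
  rintro _ ⟨x, hx, rfl⟩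
  obtain ⟨n, hn⟩ := Set.mem_iUnion.mp hx
  exact ⟨x, (mem_MSetH_of_mem_sdsF hn).1, rfl⟩

theorem exists_isLeast_wB (hT : 0 < E.T) {t : ℕ} {b : B}
    (hne : (sdsF P SDS E t m 0 (Sum.inr b)).Nonempty) :
    ∃ N, ∀ n ≥ N, IsLeast ((fun x => Vpay P E x t b) '' sdsConj P SDS E t m (Sum.inr b))
      (wB P E t (sdsF P SDS E t m n) b) := by
  refine exists_isLeast_sInf_image (monotone_sdsF (Sum.inr b)) _ hne
    ((finite_payoffs (E := E.swap) P.swap hT t b).subset ?_)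
  rintro _ ⟨x, hx, rfl⟩
  obtain ⟨n, hn⟩ := Set.mem_iUnion.mp hx
  exact ⟨x.swap, (mem_MSetH_of_mem_sdsF hn).1.swap, rfl⟩

omit [DecidableEq A] [DecidableEq B] in
theorem agreeUpTo_zero : agreeUpTo m m' 0 := fun _ hs => absurd hs (Nat.not_lt_zero _)

/-- Economies whose delayed and continuation problems are solvable have solutions. -/
theorem exists_isSolution (hS : IsSDSFamily P SDS) (hD : E.Disj) (hT : 0 < E.T)
    (hne : ∀ k, inPeriodOne E k → (sdsF P SDS E 0 emptyM 0 k).Nonempty)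
    (hcont : ∀ m, IsMatching E m → (SDS (contEconomy E m 1)).Nonempty)
    (hsol : ∀ m, IsMatching E m → 1 < E.T → ∀ m' ∈ SDS (contEconomy E m 1),
      IsSolution P (contEconomy E m 1) (sdsConj P SDS (contEconomy E m 1)) m') :
    ∃ m, IsSolution P E (sdsConj P SDS E) m := by
  choose! nA hnA using fun a (ha : a ∈ E.arrA 0) =>
    exists_isLeast_wA (P := P) hT (hne (Sum.inl a) ha)
  choose! nB hnB using fun b (hb : b ∈ E.arrB 0) =>
    exists_isLeast_wB (P := P) hT (hne (Sum.inr b) hb)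
  set N := (E.arrA 0).sup nA ⊔ (E.arrB 0).sup nB
  have hlA := fun a (ha : a ∈ E.arrA 0) => hnA a ha N ((Finset.le_sup ha).trans le_sup_left)
  have hlB := fun b (hb : b ∈ E.arrB 0) => hnB b hb N ((Finset.le_sup hb).trans le_sup_right)
  set C := sdsF P SDS E 0 emptyM N with hC
  obtain ⟨M, hM, huA, huB, hIR, hst⟩ :=
    exists_stable_pairs (E.arrA 0) (E.arrB 0) P.u P.v (wA P E 0 C) (wB P E 0 C)
  obtain ⟨m₀, hm₀, hMA, hMB⟩ := exists_matching_of_pairs hM huA huB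
  obtain ⟨m', hm'⟩ := hcont m₀ hm₀
  have hm'M := hS.isMatching hm'
  set m := splice m₀ m' 1 with hmdef
  have hm : IsMatching E m := hm₀.splice hD hT hm'M
  replace hMA : ∀ a b, m.mA 0 a = some b ↔ (a, b) ∈ M := fun a b => by
    rw [hmdef, splice_one_mA_zero, hMA]
  replace hMB : ∀ a b, m.mB 0 b = some a ↔ (a, b) ∈ M := fun a b => by
    rw [hmdef, splice_one_mB_zero, hMB]
  have hres : restrictM m 1 ∈ SDS (contEconomy E m 1) := by
    rw [← contEconomy_congr (agreeUpTo_splice (m := m₀) (m' := m'))]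
    exact hS.congr (agreeUpTo_restrict_splice hD hT hm₀ hm'M) hm'
  have hcand : m ∈ candT P SDS E 0 emptyM C := by
    refine ⟨⟨hm, agreeUpTo_zero⟩, ?_, hres⟩
    unfold StableInduced
    rw [availA_zero, availB_zero]
    refine ⟨fun a _ b h => ?_, fun b _ a h => ?_, fun a _ b h => ?_, fun b _ a h => ?_,
      fun a ha b hb hbl => ?_⟩
    · exact ⟨(Finset.mem_product.mp (hM ((hMA a b).mp h))).2, (hMB a b).mpr ((hMA a b).mp h)⟩
    · exact ⟨(Finset.mem_product.mp (hM ((hMB a b).mp h))).1, (hMA a b).mpr ((hMB a b).mp h)⟩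
    · exact (hIR a b ((hMA a b).mp h)).1
    · exact (hIR a b ((hMB a b).mp h)).2
    · obtain ⟨h1, h2⟩ := hbl
      refine hst a ha b hb ⟨?_, ?_, fun b' h => ?_, fun a' h => ?_⟩
      · cases h : m.mA 0 a with
        | none => rwa [h] at h1
        | some b' =>
          rw [h] at h1
          exact (hIR a b' ((hMA a b').mp h)).1.trans_lt h1
      · cases h : m.mB 0 b with
        | none => rwa [h] at h2
        | some a' =>
          rw [h] at h2
          exact (hIR a' b ((hMB a' b).mp h)).2.trans_lt h2
      · rwa [(hMA a b').mpr h] at h1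
      · rwa [(hMB a' b).mpr h] at h2
  have hconj : ∀ k, unmatchedAt m 0 k → m ∈ sdsConj P SDS E 0 emptyM k := fun k hk =>
    Set.mem_iUnion.mpr ⟨N + 1, Or.inr ⟨hcand, hk⟩⟩
  refine ⟨m, hm, fun t ht => ?_⟩
  rcases t with _ | t
  · rw [availA_zero, availB_zero, sdsConj_congr (agreeUpTo_zero (m' := emptyM))]
    refine ⟨fun a ha => ?_, fun b hb => ?_, fun a ha b hb hbl => ?_⟩
    · cases h : m.mA 0 a with
      | none => exact ⟨m, hconj (Sum.inl a) h, le_rfl⟩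
      | some b =>
        obtain ⟨x, hx, hxw⟩ := (hlA a ha).1
        refine ⟨x, hx, ?_⟩
        rw [Upay_of_matched P hm hT h]
        exact hxw.trans_le (hIR a b ((hMA a b).mp h)).1
    · cases h : m.mB 0 b with
      | none => exact ⟨m, hconj (Sum.inr b) h, le_rfl⟩
      | some a =>
        obtain ⟨x, hx, hxw⟩ := (hlB b hb).1
        refine ⟨x, hx, ?_⟩
        rw [Vpay_of_matched P hm hT h]
        exact hxw.trans_le (hIR a b ((hMB a b).mp h)).2
    · have hle : indU P (wA P E 0 C) a (m.mA 0 a) ≤ Upay P E m 0 a := by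
        cases h : m.mA 0 a with
        | none => exact (hlA a ha).2 ⟨m, hconj (Sum.inl a) h, rfl⟩
        | some b' => exact (Upay_of_matched P hm hT h).ge
      have hle' : indV P (wB P E 0 C) b (m.mB 0 b) ≤ Vpay P E m 0 b := by
        cases h : m.mB 0 b with
        | none => exact (hlB b hb).2 ⟨m, hconj (Sum.inr b) h, rfl⟩
        | some a' => exact (Vpay_of_matched P hm hT h).ge
      exact hcand.2.1.2.2.2.2 a (by rwa [availA_zero]) b (by rwa [availB_zero])
        ⟨hle.trans_lt hbl.1, hle'.trans_lt hbl.2⟩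
  · exact (hsol m hm (by omega) _ hres).of_contEconomy hS hD hm ht

theorem unmatchedAt_of_mem_sdsF {t n : ℕ} {k : Agent A B} {x : PreMatching A B}
    (hx : x ∈ sdsF P SDS E t m n k) : unmatchedAt x t k := by
  induction n with
  | zero =>
    have := hx.1.2.2
    cases k <;> exact this t le_rfl
  | succ n ih => exact hx.elim ih fun h => h.2

/-- In one-period economies, static stability agrees with the solution concept induced by
the conjectures. -/
theorem isSolution_iff_stable1 (hT : E.T = 1)
    (hne : ∀ k, inPeriodOne E k → (sdsF P SDS E 0 emptyM 0 k).Nonempty) :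
    IsSolution P E (sdsConj P SDS E) m ↔ Stable1 P E m := by
  have hT0 : 0 < E.T := by omega
  have hlast : E.T - 1 = 0 := by omega
  have zA : ∀ x a, x ∈ sdsConj P SDS E 0 m (Sum.inl a) → Upay P E x 0 a = 0 := by
    intro x a hx
    obtain ⟨n, hn⟩ := Set.mem_iUnion.mp hx
    have h : x.mA 0 a = none := unmatchedAt_of_mem_sdsF hn
    simp only [Upay, hlast, h]
  have zB : ∀ x b, x ∈ sdsConj P SDS E 0 m (Sum.inr b) → Vpay P E x 0 b = 0 := by
    intro x b hx
    obtain ⟨n, hn⟩ := Set.mem_iUnion.mp hx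
    have h : x.mB 0 b = none := unmatchedAt_of_mem_sdsF hn
    simp only [Vpay, hlast, h]
  have hne' : ∀ k, inPeriodOne E k → (sdsConj P SDS E 0 m k).Nonempty := fun k hk => by
    rw [sdsConj_congr (agreeUpTo_zero (m' := emptyM))]
    exact (hne k hk).mono (Set.subset_iUnion (fun n => sdsF P SDS E 0 emptyM n k) 0)
  constructor
  · rintro ⟨hm, h⟩
    obtain ⟨h1, h2, h3⟩ := h 0 hT0
    rw [availA_zero, availB_zero] at *
    rw [Stable1, hlast]
    refine ⟨hm, fun a b hab => ?_, fun b a hab => ?_, h3⟩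
    · obtain ⟨x, hx, hle⟩ := h1 a (hm.arrA_zero hT0 (by simp [hab]))
      rwa [zA x a hx, Upay_of_matched P hm hT0 hab] at hle
    · obtain ⟨x, hx, hle⟩ := h2 b
        (hm.swap.arrA_zero hT0 (by change m.mB 0 b ≠ none; simp [hab]))
      rwa [zB x b hx, Vpay_of_matched P hm hT0 hab] at hle
  · rintro ⟨hm, h1, h2, h3⟩
    rw [hlast] at h1 h2
    refine ⟨hm, fun t ht => ?_⟩
    obtain rfl : t = 0 := by omega
    rw [availA_zero, availB_zero]
    refine ⟨fun a ha => ?_, fun b hb => ?_, h3⟩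
    · obtain ⟨x, hx⟩ := hne' (Sum.inl a) ha
      refine ⟨x, hx, ?_⟩
      rw [zA x a hx]
      cases h : m.mA 0 a with
      | none => simp only [Upay, hlast, h, le_refl]
      | some b => exact (Upay_of_matched P hm hT0 h).ge.trans' (h1 a b h)
    · obtain ⟨x, hx⟩ := hne' (Sum.inr b) hb
      refine ⟨x, hx, ?_⟩
      rw [zB x b hx]
      cases h : m.mB 0 b with
      | none => simp only [Vpay, hlast, h, le_refl]
      | some a => exact (Vpay_of_matched P hm hT0 h).ge.trans' (h2 b a h)

theorem IsSDSFamily.mem_iff_isSolution (hS : IsSDSFamily P SDS) (hT : 0 < E.T)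
    (hne : ∀ k, inPeriodOne E k → (sdsF P SDS E 0 emptyM 0 k).Nonempty) :
    m ∈ SDS E ↔ IsSolution P E (sdsConj P SDS E) m := by
  obtain h1 | h2 : E.T = 1 ∨ 2 ≤ E.T := by omega
  · rw [isSolution_iff_stable1 h1 hne, hS.2.1 E h1]
    rfl
  · rw [hS.2.2 E h2]
    rfl

end

/-! ### Delayed arrivals -/

theorem delayEconomy_T (k : Agent A B) : (delayEconomy E k).T = E.T := by
  cases k <;> rfl

theorem mem_delayEconomy_arrA {a c : A} {s : ℕ} :
    c ∈ (delayEconomy E (Sum.inl a)).arrA s ↔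
      (s = 1 ∧ c = a) ∨ (c ∈ E.arrA s ∧ (s = 0 → c ≠ a)) := by
  rcases s with _ | _ | s <;> simp [delayEconomy]

theorem Economy.Disj.delay (hD : E.Disj) {k : Agent A B} (hk : inPeriodOne E k) :
    (delayEconomy E k).Disj := by
  have aux : ∀ {A B : Type} [DecidableEq A] [DecidableEq B] {E : Economy A B} {a : A},
      E.Disj → a ∈ E.arrA 0 → (delayEconomy E (Sum.inl a)).Disj := by
    intro A B _ _ E a hD ha
    refine ⟨fun s t hst => Finset.disjoint_left.mpr fun c hs ht => ?_, hD.2⟩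
    rw [mem_delayEconomy_arrA] at hs ht
    rcases hs with ⟨rfl, rfl⟩ | ⟨hs, hs0⟩ <;> rcases ht with ⟨rfl, ht⟩ | ⟨ht, ht0⟩
    · exact hst rfl
    · exact ht0 (hD.eqA ht ha) rfl
    · subst ht; exact hs0 (hD.eqA hs ha) rfl
    · exact hst (hD.eqA hs ht)
  cases k with
  | inl a => exact aux hD hk
  | inr b => exact (aux (E := E.swap) hD.swap hk).swap

theorem card_delayEconomy_lt {k : Agent A B} (hk : inPeriodOne E k) :
    ((delayEconomy E k).arrA 0).card + ((delayEconomy E k).arrB 0).card <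
      (E.arrA 0).card + (E.arrB 0).card := by
  cases k with
  | inl a =>
    refine Nat.add_lt_add_right (Finset.card_lt_card ?_) _
    exact Finset.sdiff_ssubset (Finset.singleton_subset_iff.mpr hk) (Finset.singleton_nonempty a)
  | inr b =>
    refine Nat.add_lt_add_left (Finset.card_lt_card ?_) _
    exact Finset.sdiff_ssubset (Finset.singleton_subset_iff.mpr hk) (Finset.singleton_nonempty b)

theorem IsMatching.of_delayEconomy {k : Agent A B} (hk : inPeriodOne E k) (hT : 0 < E.T)
    (hm : IsMatching (delayEconomy E k) m) : IsMatching E m ∧ unmatchedThrough m 0 k := by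
  have aux : ∀ {A B : Type} [DecidableEq A] [DecidableEq B] {E : Economy A B}
      {m : PreMatching A B} {a : A}, a ∈ E.arrA 0 → 0 < E.T →
      IsMatching (delayEconomy E (Sum.inl a)) m →
      IsMatching E m ∧ unmatchedThrough m 0 (Sum.inl a) := by
    intro A B _ _ E m a ha hT hm
    refine ⟨⟨hm.1, fun t c ht h => ?_, hm.2.2.1, hm.2.2.2⟩, fun s hs => ?_⟩
    · obtain ⟨s, hs, hc⟩ := mem_arrAUpTo.mp (hm.2.1 t c ht h)
      rcases mem_delayEconomy_arrA.mp hc with ⟨rfl, rfl⟩ | ⟨hc, -⟩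
      · exact mem_arrAUpTo.mpr ⟨0, t.zero_le, ha⟩
      · exact mem_arrAUpTo.mpr ⟨s, hs, hc⟩
    · obtain rfl : s = 0 := by omega
      by_contra hne
      simpa [mem_delayEconomy_arrA] using hm.arrA_zero hT hne
  cases k with
  | inl a => exact aux hk hT hm
  | inr b =>
    obtain ⟨h1, h2⟩ := aux (E := E.swap) (m := m.swap) hk hT hm.swap
    exact ⟨h1.swap, h2⟩

theorem sdsF_zero_nonempty {P : Pref A B} {SDS : Economy A B → Set (PreMatching A B)}
    (hS : IsSDSFamily P SDS) (hT : 0 < E.T) {k : Agent A B} (hk : inPeriodOne E k)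
    (h : (SDS (delayEconomy E k)).Nonempty) : (sdsF P SDS E 0 emptyM 0 k).Nonempty := by
  obtain ⟨x, hx⟩ := h
  obtain ⟨h1, h2⟩ := (hS.isMatching hx).of_delayEconomy hk hT
  refine ⟨x, ⟨h1, agreeUpTo_zero, h2⟩, ?_⟩
  rwa [restrictM_zero, contEconomy_zero]

theorem IsSDSFamily.nonempty {P : Pref A B} {SDS : Economy A B → Set (PreMatching A B)}
    (hS : IsSDSFamily P SDS) (E : Economy A B) (hD : E.Disj) : (SDS E).Nonempty := by
  obtain h0 | hT := Nat.eq_zero_or_pos E.T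
  · rw [hS.1 E h0]
    exact ⟨emptyM, trivial⟩
  have hne : ∀ k, inPeriodOne E k → (sdsF P SDS E 0 emptyM 0 k).Nonempty := fun k hk =>
    have hT' := delayEconomy_T (E := E) k
    have hcard := card_delayEconomy_lt hk
    sdsF_zero_nonempty hS hT hk (hS.nonempty _ (hD.delay hk))
  obtain ⟨m, hm⟩ := exists_isSolution hS hD hT hne
    (fun m _ =>
      have hT' : (contEconomy E m 1).T < E.T := Nat.sub_lt hT one_pos
      hS.nonempty _ hD.contEconomy)
    (fun m _ h1 m' hm' => by
      have hT' : (contEconomy E m 1).T < E.T := Nat.sub_lt hT one_pos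
      have hpos : 0 < (contEconomy E m 1).T := Nat.sub_pos_of_lt h1
      refine (hS.mem_iff_isSolution hpos fun k hk => ?_).mp hm'
      have hT'' := delayEconomy_T (E := contEconomy E m 1) k
      exact sdsF_zero_nonempty hS hpos hk (hS.nonempty _ (hD.contEconomy.delay hk)))
  exact ⟨m, (hS.mem_iff_isSolution hT hne).mpr hm⟩
termination_by (E.T, (E.arrA 0).card + (E.arrB 0).card)
decreasing_by
  · rw [Prod.lex_def]; exact Or.inr ⟨hT', hcard⟩
  · rw [Prod.lex_def]; exact Or.inl hT'
  · rw [Prod.lex_def]; exact Or.inl (hT''.trans_lt hT')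

end

/-- Corollary 2: for every `T` and every length-`T` economy, the set of
sophisticated dynamically stable matchings is nonempty. -/
theorem statement12
    (A B : Type) [DecidableEq A] [DecidableEq B]
    (P : Pref A B) (hP : P.Valid)
    (SDS : Economy A B → Set (PreMatching A B)) (hSDS : IsSDSFamily P SDS)
    (E : Economy A B) (hE : E.Valid) :
    (SDS E).Nonempty := by
  exact hSDS.nonempty E ⟨hE.2.1, hE.2.2.1⟩

end

end DynMatch
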